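/- arXiv:math/0611617 — 7 statements merged into one kernel-verified Lean document; each statement's English description precedes it below -/
import Mathlib

section
/- Let A be a finite ring and let M, N, Q, R be finite A-modules. Then Σ_{[S]} g^S_{M,N} · g^R_{S,Q} = Σ_{[T]} g^T_{N,Q} · g^R_{M,T}, where both sums range over isomorphism classes of finite A-modules and have only finitely many nonzero terms; moreover both sides equal the number of chains of A-submodules L₂ ⊆ L₁ ⊆ R such that L₂ ≅ Q, L₁/L₂ ≅ N and R/L₁ ≅ M. (This identity is the associativity of the untwisted Ringel–Hall product [M]·[N] = Σ_{[R]} g^R_{M,N} [R] on the free ℚ-module with basis the isomorphism classes of finite A-modules, whose unit is the class of the zero module.) -/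
/-- A bundled finite left module over the ring `A`. -/
structure FinMod (A : Type) [Ring A] : Type 1 where
  /-- the underlying type -/
  carrier : Type
  [addCommGroup : AddCommGroup carrier]
  [module : Module A carrier]
  [finite : Finite carrier]

attribute [instance] FinMod.addCommGroup FinMod.module FinMod.finite

/-- `hallG A M N R` is the Hall number `g^R_{M,N}` : the number of `A`-submodules `L ⊆ R`
with `L` isomorphic to `N` and `R/L` isomorphic to `M`. -/
noncomputable def hallG (A : Type) [Ring A] (M N R : Type)
    [AddCommGroup M] [Module A M] [AddCommGroup N] [Module A N]
    [AddCommGroup R] [Module A R] : ℕ :=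
  Nat.card {L : Submodule A R // Nonempty (↥L ≃ₗ[A] N) ∧ Nonempty ((R ⧸ L) ≃ₗ[A] M)}

/-- Weighted counting of a finite type through the fibres of a relation that assigns to each
element a unique label. -/
theorem finite_support_and_finsum_mul_card_fiber {X ι : Type*} [Fintype X] (r : X → ι → Prop)
    (hr : ∀ x, ∃! i, r x i) (P : X → Prop) (f : X → ℕ) (h : ι → ℕ)
    (hf : ∀ x i, r x i → P x → f x = h i) (hf0 : ∀ x, ¬ P x → f x = 0) :
    (Function.support fun i => h i * Nat.card {x // r x i ∧ P x}).Finite ∧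
      ∑ᶠ i, h i * Nat.card {x // r x i ∧ P x} = ∑ x, f x := by
  classical
  choose c hc hcu using hr
  have key (i : ι) : h i * Nat.card {x // r x i ∧ P x} = ∑ x with c x = i, f x := by
    rw [Nat.card_eq_fintype_card, Fintype.card_subtype, mul_comm, ← smul_eq_mul,
      ← Finset.sum_const]
    refine Finset.sum_subset_zero_on_sdiff ?_ ?_ ?_
    · intro x hx
      simp only [Finset.mem_filter, Finset.mem_univ, true_and] at hx ⊢
      exact (hcu x i hx.1).symm
    · intro x hx
      simp only [Finset.mem_sdiff, Finset.mem_filter, Finset.mem_univ, true_and] at hx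
      obtain ⟨rfl, hx⟩ := hx
      exact hf0 x fun hP => hx ⟨hc x, hP⟩
    · intro x hx
      simp only [Finset.mem_filter, Finset.mem_univ, true_and] at hx
      exact (hf x i hx.1 hx.2).symm
  have hsupp : (Function.support fun i => h i * Nat.card {x // r x i ∧ P x}) ⊆
      (Finset.univ.image c : Finset ι) := by
    intro i hi
    rw [Function.mem_support, key] at hi
    obtain ⟨x, hx, -⟩ := Finset.exists_ne_zero_of_sum_ne_zero hi
    simp only [Finset.mem_filter, Finset.mem_univ, true_and] at hx
    simp [← hx]
  refine ⟨(Finset.finite_toSet _).subset hsupp, ?_⟩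
  rw [finsum_eq_sum_of_support_subset _ hsupp, Finset.sum_congr rfl fun i _ => key i]
  exact Finset.sum_fiberwise_of_maps_to (fun x hx => Finset.mem_image_of_mem c hx) f

/-- A linear equivalence may be precomposed on either side of `Nonempty`. -/
theorem LinearEquiv.nonempty_congr_left {A M M' N : Type*} [Ring A]
    [AddCommGroup M] [Module A M] [AddCommGroup M'] [Module A M'] [AddCommGroup N] [Module A N]
    (e : M ≃ₗ[A] M') : Nonempty (M ≃ₗ[A] N) ↔ Nonempty (M' ≃ₗ[A] N) :=
  ⟨fun ⟨g⟩ => ⟨e.symm.trans g⟩, fun ⟨g⟩ => ⟨e.trans g⟩⟩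

theorem hallG_congr {A M N R R' : Type} [Ring A]
    [AddCommGroup M] [Module A M] [AddCommGroup N] [Module A N]
    [AddCommGroup R] [Module A R] [AddCommGroup R'] [Module A R'] (e : R ≃ₗ[A] R') :
    hallG A M N R = hallG A M N R' :=
  Nat.card_congr <| (Submodule.orderIsoMapComap e).toEquiv.subtypeEquiv fun L =>
    and_congr (e.submoduleMap L).nonempty_congr_left
      (Submodule.Quotient.equiv L _ e rfl).nonempty_congr_left

/-- For `S ≤ T`, the image of `T` in `R ⧸ S` is `T ⧸ S`. -/
noncomputable def Submodule.mapMkQEquiv {A R : Type*} [Ring A] [AddCommGroup R] [Module A R]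
    (S T : Submodule A R) : ↥(T.map S.mkQ) ≃ₗ[A] ↥T ⧸ Submodule.comap T.subtype S :=
  (LinearEquiv.ofEq _ _ (by rw [LinearMap.range_comp, Submodule.range_subtype])).trans
    ((Submodule.quotEquivOfEq _ _ (by rw [LinearMap.ker_comp, Submodule.ker_mkQ])).trans
      (S.mkQ.comp T.subtype).quotKerEquivRange).symm

/-- Submodules of a submodule `T`, with prescribed isomorphism types of the submodule and the
quotient, are counted by `hallG`. -/
theorem card_submodules_le_eq_hallG {A N Q R : Type} [Ring A]
    [AddCommGroup N] [Module A N] [AddCommGroup Q] [Module A Q]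
    [AddCommGroup R] [Module A R] (T : Submodule A R) :
    Nat.card {S : Submodule A R // S ≤ T ∧ Nonempty (↥S ≃ₗ[A] Q) ∧
      Nonempty ((↥T ⧸ Submodule.comap T.subtype S) ≃ₗ[A] N)} = hallG A N Q ↥T := by
  refine Nat.card_congr <| (Equiv.subtypeSubtypeEquivSubtypeInter (· ≤ T) _).symm.trans <|
    (T.mapIic.toEquiv.subtypeEquiv fun L => ?_).symm
  have hL : Submodule.comap T.subtype (T.mapIic L : Submodule A R) = L :=
    Submodule.comap_map_eq_of_injective T.injective_subtype L
  exact and_congr (Submodule.equivMapOfInjective T.subtype T.injective_subtype L).nonempty_congr_left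
    (Submodule.quotEquivOfEq _ _ hL.symm).nonempty_congr_left

/-- Submodules containing `S`, with prescribed isomorphism types of the two quotients, are
counted by `hallG`. -/
theorem card_submodules_ge_eq_hallG {A M N R : Type} [Ring A]
    [AddCommGroup M] [Module A M] [AddCommGroup N] [Module A N]
    [AddCommGroup R] [Module A R] (S : Submodule A R) :
    Nat.card {T : Submodule A R // S ≤ T ∧
      Nonempty ((↥T ⧸ Submodule.comap T.subtype S) ≃ₗ[A] N) ∧ Nonempty ((R ⧸ T) ≃ₗ[A] M)} =
      hallG A M N (R ⧸ S) := by
  refine Nat.card_congr <| (Equiv.subtypeSubtypeEquivSubtypeInter (S ≤ ·) _).symm.trans <|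
    ((Submodule.comapMkQRelIso S).toEquiv.symm.subtypeEquiv fun T => ?_)
  have hT : (Submodule.comapMkQRelIso S).symm T = (T : Submodule A R).map S.mkQ := rfl
  exact and_congr (Submodule.mapMkQEquiv S T).symm.nonempty_congr_left
    (Submodule.quotientQuotientEquivQuotient S T T.2).symm.nonempty_congr_left

/-- Associativity of the (untwisted) Ringel–Hall product: for a finite ring `A` and finite
`A`-modules `M, N, Q, R`, and any complete irredundant family `V : ι → FinMod A` of
representatives of the isomorphism classes of finite `A`-modules, the two iterated
Hall-number sums have finite support, they are equal, and both equal the number of chains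
of submodules `L₂ ⊆ L₁ ⊆ R` with `L₂ ≅ Q`, `L₁/L₂ ≅ N` and `R/L₁ ≅ M`. -/
theorem hall_product_associative
    (A : Type) [Ring A] [Finite A]
    (M N Q R : Type)
    [AddCommGroup M] [Module A M] [Finite M]
    [AddCommGroup N] [Module A N] [Finite N]
    [AddCommGroup Q] [Module A Q] [Finite Q]
    [AddCommGroup R] [Module A R] [Finite R]
    (ι : Type) (V : ι → FinMod A)
    (hrep : ∀ W : FinMod A, ∃! i : ι, Nonempty (W.carrier ≃ₗ[A] (V i).carrier)) :
    (Function.support fun i : ι =>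
      hallG A M N (V i).carrier * hallG A (V i).carrier Q R).Finite ∧
    (Function.support fun i : ι =>
      hallG A N Q (V i).carrier * hallG A M (V i).carrier R).Finite ∧
    (∑ᶠ i : ι, hallG A M N (V i).carrier * hallG A (V i).carrier Q R)
      = (∑ᶠ i : ι, hallG A N Q (V i).carrier * hallG A M (V i).carrier R) ∧
    (∑ᶠ i : ι, hallG A M N (V i).carrier * hallG A (V i).carrier Q R)
      = Nat.card {p : Submodule A R × Submodule A R // p.1 ≤ p.2 ∧
          Nonempty (↥p.1 ≃ₗ[A] Q) ∧
          Nonempty ((↥p.2 ⧸ Submodule.comap p.2.subtype p.1) ≃ₗ[A] N) ∧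
          Nonempty ((R ⧸ p.2) ≃ₗ[A] M)} := by
  classical
  have := Fintype.ofFinite (Submodule A R)
  have (L : Submodule A R) : Finite (R ⧸ L) := Finite.of_surjective L.mkQ L.mkQ_surjective
  have left := finite_support_and_finsum_mul_card_fiber
    (fun (L : Submodule A R) i => Nonempty ((R ⧸ L) ≃ₗ[A] (V i).carrier))
    (fun L => hrep ⟨R ⧸ L⟩) (fun L => Nonempty (↥L ≃ₗ[A] Q))
    (fun L => Nat.card {T : Submodule A R // L ≤ T ∧ Nonempty (↥L ≃ₗ[A] Q) ∧
      Nonempty ((↥T ⧸ Submodule.comap T.subtype L) ≃ₗ[A] N) ∧ Nonempty ((R ⧸ T) ≃ₗ[A] M)})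
    (fun i => hallG A M N (V i).carrier)
    (fun L i ⟨e⟩ hL => by
      simpa only [hL, true_and, card_submodules_ge_eq_hallG] using hallG_congr e)
    (fun L hL => by simp [hL])
  have right := finite_support_and_finsum_mul_card_fiber
    (fun (L : Submodule A R) i => Nonempty (↥L ≃ₗ[A] (V i).carrier))
    (fun L => hrep ⟨↥L⟩) (fun L => Nonempty ((R ⧸ L) ≃ₗ[A] M))
    (fun L => Nat.card {S : Submodule A R // S ≤ L ∧ Nonempty (↥S ≃ₗ[A] Q) ∧
      Nonempty ((↥L ⧸ Submodule.comap L.subtype S) ≃ₗ[A] N) ∧ Nonempty ((R ⧸ L) ≃ₗ[A] M)})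
    (fun i => hallG A N Q (V i).carrier)
    (fun L i ⟨e⟩ hL => by
      simpa only [hL, and_true, card_submodules_le_eq_hallG] using hallG_congr e)
    (fun L hL => by simp [hL])
  simp only [and_comm (a := Nonempty ((R ⧸ _) ≃ₗ[A] (V _).carrier))] at left
  rw [← Nat.card_sigma] at left right
  have hleft := left.2.trans (Nat.card_congr (Equiv.subtypeProdEquivSigmaSubtype
    fun S T : Submodule A R => S ≤ T ∧ Nonempty (↥S ≃ₗ[A] Q) ∧
      Nonempty ((↥T ⧸ Submodule.comap T.subtype S) ≃ₗ[A] N) ∧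
      Nonempty ((R ⧸ T) ≃ₗ[A] M)).symm)
  have hswap : Nat.card {p : Submodule A R × Submodule A R // p.1 ≤ p.2 ∧
      Nonempty (↥p.1 ≃ₗ[A] Q) ∧
      Nonempty ((↥p.2 ⧸ Submodule.comap p.2.subtype p.1) ≃ₗ[A] N) ∧
      Nonempty ((R ⧸ p.2) ≃ₗ[A] M)} = _ :=
    Nat.card_congr (((Equiv.prodComm _ _).subtypeEquiv fun _ => Iff.rfl).trans
      (Equiv.subtypeProdEquivSigmaSubtype
        fun T S : Submodule A R => S ≤ T ∧ Nonempty (↥S ≃ₗ[A] Q) ∧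
          Nonempty ((↥T ⧸ Submodule.comap T.subtype S) ≃ₗ[A] N) ∧
          Nonempty ((R ⧸ T) ≃ₗ[A] M)))
  exact ⟨left.1, right.1, hleft.trans (hswap.trans right.2.symm), hleft⟩
end

section
/- Let A be a finite ring and let M, N, Q, R be finite A-modules. Then Σ_{[S]} (1/a_S) · P^S_{M,N} · P^R_{S,Q} = Σ_{[T]} (1/a_T) · P^T_{N,Q} · P^R_{M,T}, an equality of rational numbers in which both sums range over isomorphism classes of finite A-modules and have only finitely many nonzero terms. (This identity expresses the coassociativity of Green's coproduct on the Hall algebra.) -/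
/-- `autCard A M` is `a_M`, the number of `A`-module automorphisms of `M`. -/
noncomputable def autCard (A : Type) [Ring A] (M : Type) [AddCommGroup M] [Module A M] : ℕ :=
  Nat.card (M ≃ₗ[A] M)

/-- `hallP A M N R` is `P^R_{M,N}`, the number of short exact sequences `0 → N → R → M → 0`,
i.e. of pairs `(a, b)` with `a : N → R` injective `A`-linear, `b : R → M` surjective
`A`-linear and `range a = ker b`. -/
noncomputable def hallP (A : Type) [Ring A] (M N R : Type)
    [AddCommGroup M] [Module A M] [AddCommGroup N] [Module A N]
    [AddCommGroup R] [Module A R] : ℕ :=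
  Nat.card {ab : (N →ₗ[A] R) × (R →ₗ[A] M) //
    Function.Injective ab.1 ∧ Function.Surjective ab.2 ∧
      LinearMap.range ab.1 = LinearMap.ker ab.2}

namespace HallCoassoc

open Function

section Lifting

variable {A : Type*} [Ring A] {X Y Z : Type*} [AddCommGroup X] [Module A X]
  [AddCommGroup Y] [Module A Y] [AddCommGroup Z] [Module A Z]

/-- A linear map factors through a surjection whose kernel it kills. -/
lemma exists_factor_of_surjective (f : X →ₗ[A] Y) (g : X →ₗ[A] Z) (hf : Surjective f)
    (h : ∀ x, f x = 0 → g x = 0) : ∃ k : Y →ₗ[A] Z, ∀ x, k (f x) = g x := by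
  refine ⟨((LinearMap.ker f).liftQ g fun x hx => h x hx) ∘ₗ
    (f.quotKerEquivOfSurjective hf).symm.toLinearMap, fun x => ?_⟩
  have : (f.quotKerEquivOfSurjective hf).symm (f x) = Submodule.Quotient.mk x := by
    rw [LinearEquiv.symm_apply_eq]; rfl
  simp only [LinearMap.comp_apply, LinearEquiv.coe_coe, this]
  rfl

/-- A linear map factors through an injection whose range contains its values. -/
lemma exists_factor_of_injective (f : X →ₗ[A] Y) (g : Z →ₗ[A] Y) (hf : Injective f)
    (h : ∀ z, ∃ x, f x = g z) : ∃ k : Z →ₗ[A] X, ∀ z, f (k z) = g z := by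
  refine ⟨(LinearEquiv.ofInjective f hf).symm.toLinearMap ∘ₗ
    g.codRestrict (LinearMap.range f) h, fun z => ?_⟩
  have := (LinearEquiv.ofInjective f hf).apply_symm_apply (g.codRestrict (LinearMap.range f) h z)
  exact congrArg Subtype.val this

/-- Surjections with kernel `K` are isomorphisms out of the quotient by `K`. -/
lemma card_surjective_ker_eq (K : Submodule A X) :
    Nat.card {d : X →ₗ[A] Y // Surjective d ∧ LinearMap.ker d = K} =
      Nat.card ((X ⧸ K) ≃ₗ[A] Y) := by
  symm
  refine Nat.card_eq_of_bijective
    (fun φ => ⟨φ.toLinearMap ∘ₗ K.mkQ, φ.surjective.comp K.mkQ_surjective, ?_⟩) ⟨?_, ?_⟩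
  · ext x; simp
  · intro φ ψ h
    ext x
    obtain ⟨x, rfl⟩ := K.mkQ_surjective x
    exact LinearMap.congr_fun (congrArg Subtype.val h) x
  · rintro ⟨d, hd, rfl⟩
    refine ⟨d.quotKerEquivOfSurjective hd, ?_⟩
    ext x
    rfl

/-- Injections with range `K` are isomorphisms from `K`. -/
lemma card_injective_range_eq (K : Submodule A X) :
    Nat.card {c : Y →ₗ[A] X // Injective c ∧ LinearMap.range c = K} = Nat.card (K ≃ₗ[A] Y) := by
  symm
  refine Nat.card_eq_of_bijective
    (fun φ => ⟨K.subtype ∘ₗ φ.symm.toLinearMap, K.subtype_injective.comp φ.symm.injective, ?_⟩)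
    ⟨?_, ?_⟩
  · rw [LinearMap.range_comp, LinearEquiv.range, Submodule.map_top, Submodule.range_subtype]
  · intro φ ψ h
    apply LinearEquiv.symm_bijective.injective
    ext y
    exact LinearMap.congr_fun (congrArg Subtype.val h) y
  · rintro ⟨c, hc, rfl⟩
    refine ⟨(LinearEquiv.ofInjective c hc).symm, ?_⟩
    ext y
    rfl

lemma mem_range_prod {f : X →ₗ[A] Y} {g : X →ₗ[A] Z} {y : Y} {z : Z} :
    (y, z) ∈ LinearMap.range (f.prod g) ↔ ∃ x, f x = y ∧ g x = z :=
  exists_congr fun _ => Prod.mk.injEq _ _ _ _ ▸ Iff.rfl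

end Lifting

/-- Counting a finite family of modules by isomorphism class, each weighted by its
isomorphisms to the representative divided by the automorphisms of the representative. -/
lemma finsum_isomorphisms (A : Type) [Ring A] {ι : Type} (V : ι → FinMod A)
    (hrep : ∀ W : FinMod A, ∃! i : ι, Nonempty (W.carrier ≃ₗ[A] (V i).carrier))
    {Z : Type} [Fintype Z] (W : Z → FinMod A) (f : ι → ℚ)
    (hf : ∀ i, f i = 1 / (autCard A (V i).carrier : ℚ) *
      ((∑ z, Nat.card ((W z).carrier ≃ₗ[A] (V i).carrier) : ℕ) : ℚ)) :
    (support f).Finite ∧ ∑ᶠ i, f i = Fintype.card Z := by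
  classical
  choose cls hcls huniq using hrep
  have key : ∀ i, f i = ∑ z, if cls (W z) = i then (1 : ℚ) else 0 := by
    intro i
    rw [hf, Nat.cast_sum, Finset.mul_sum]
    refine Finset.sum_congr rfl fun z _ => ?_
    split_ifs with h
    · subst h
      obtain ⟨e⟩ := hcls (W z)
      have hc : Nat.card ((W z).carrier ≃ₗ[A] (V (cls (W z))).carrier) =
          autCard A (V (cls (W z))).carrier :=
        Nat.card_congr
          { toFun := fun φ => e.symm.trans φ
            invFun := fun φ => e.trans φ
            left_inv := fun φ => by ext; simp
            right_inv := fun φ => by ext; simp }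
      have : Finite ((V (cls (W z))).carrier ≃ₗ[A] (V (cls (W z))).carrier) :=
        Finite.of_injective _ DFunLike.coe_injective
      have hpos : (autCard A (V (cls (W z))).carrier : ℚ) ≠ 0 := by
        have : Nonempty ((V (cls (W z))).carrier ≃ₗ[A] (V (cls (W z))).carrier) :=
          ⟨LinearEquiv.refl A _⟩
        exact_mod_cast (Nat.card_pos (α := (V (cls (W z))).carrier ≃ₗ[A] _)).ne'
      rw [hc, one_div, inv_mul_cancel₀ hpos]
    · have : IsEmpty ((W z).carrier ≃ₗ[A] (V i).carrier) :=
        ⟨fun φ => h (huniq (W z) i ⟨φ⟩).symm⟩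
      simp
  have hsub : support f ⊆ (Finset.univ.image fun z => cls (W z) : Finset ι) := by
    intro i hi
    by_contra hni
    refine hi ?_
    rw [key]
    refine Finset.sum_eq_zero fun z _ => if_neg fun h => hni ?_
    simpa using ⟨z, h⟩
  refine ⟨(Finset.finite_toSet _).subset hsub, ?_⟩
  rw [finsum_eq_sum_of_support_subset f hsub]
  simp_rw [key]
  rw [Finset.sum_comm]
  simp

variable {A : Type} [Ring A] {M N Q R : Type}
  [AddCommGroup M] [Module A M] [AddCommGroup N] [Module A N]
  [AddCommGroup Q] [Module A Q] [AddCommGroup R] [Module A R]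

variable (A M N Q R) in
/-- Two-step filtrations of `R` with successive quotients identified with `Q`, `N`, `M`:
an injection `c : Q → R`, a surjection `q : R → M`, and the graph of a surjection
`ker q → N` with kernel `range c`. -/
@[ext]
structure Filt where
  /-- the inclusion of the bottom step -/
  c : Q →ₗ[A] R
  /-- the projection to the top quotient -/
  q : R →ₗ[A] M
  /-- the graph of the projection from the middle step -/
  G : Submodule A (R × N)
  c_inj : Injective c
  q_surj : Surjective q
  dom_iff : ∀ r, (∃ n, (r, n) ∈ G) ↔ q r = 0
  exists_left : ∀ n, ∃ r, (r, n) ∈ G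
  functional : ∀ n, (0, n) ∈ G → n = 0
  ker_iff : ∀ r, (r, 0) ∈ G ↔ ∃ x, c x = r

instance [Finite M] [Finite N] [Finite Q] [Finite R] : Finite (Filt A M N Q R) := by
  have h₁ : Finite (Q →ₗ[A] R) := Finite.of_injective _ DFunLike.coe_injective
  have h₂ : Finite (R →ₗ[A] M) := Finite.of_injective _ DFunLike.coe_injective
  refine Finite.of_injective (β := (Q →ₗ[A] R) × (R →ₗ[A] M) × Submodule A (R × N))
    (fun z => (z.c, z.q, z.G)) fun z w h => ?_
  simp only [Prod.mk.injEq] at h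
  exact Filt.ext h.1 h.2.1 h.2.2

/-- Pairs of short exact sequences through a quotient `S` of `R` correspond to filtrations
of `R` together with an isomorphism of the quotient by the bottom step with `S`. -/
lemma hallP_mul_quotient [Finite M] [Finite N] [Finite Q] [Finite R]
    [Fintype (Filt A M N Q R)] (S : Type) [AddCommGroup S] [Module A S] [Finite S] :
    hallP A M N S * hallP A S Q R =
      ∑ z : Filt A M N Q R, Nat.card ((R ⧸ LinearMap.range z.c) ≃ₗ[A] S) := by
  have hfin : Finite (R →ₗ[A] S) := Finite.of_injective _ DFunLike.coe_injective
  simp_rw [← card_surjective_ker_eq]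
  rw [← Nat.card_sigma, hallP, hallP, ← Nat.card_prod]
  refine Nat.card_eq_of_bijective (fun e => ⟨
    { c := e.2.1.1
      q := e.1.1.2 ∘ₗ e.2.1.2
      G := LinearMap.eqLocus (e.2.1.2 ∘ₗ LinearMap.fst A R N) (e.1.1.1 ∘ₗ LinearMap.snd A R N)
      c_inj := e.2.2.1
      q_surj := e.1.2.2.1.comp e.2.2.2.1
      dom_iff := ?_
      exists_left := ?_
      functional := ?_
      ker_iff := ?_ }, ⟨e.2.1.2, e.2.2.2.1, e.2.2.2.2.symm⟩⟩) ⟨?_, ?_⟩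
  · intro r
    have := SetLike.ext_iff.mp e.1.2.2.2 (e.2.1.2 r)
    simp only [LinearMap.mem_range, LinearMap.mem_ker] at this
    simpa [LinearMap.mem_eqLocus, eq_comm] using this
  · intro n
    obtain ⟨r, hr⟩ := e.2.2.2.1 (e.1.1.1 n)
    exact ⟨r, by simpa [LinearMap.mem_eqLocus] using hr⟩
  · intro n hn
    refine e.1.2.1 ?_
    simpa [LinearMap.mem_eqLocus, eq_comm] using hn
  · intro r
    have := SetLike.ext_iff.mp e.2.2.2.2 r
    simp only [LinearMap.mem_range, LinearMap.mem_ker] at this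
    simpa [LinearMap.mem_eqLocus] using this.symm
  · rintro ⟨⟨⟨a, b⟩, ha, hb, hab⟩, ⟨⟨c, d⟩, hc, hd, hcd⟩⟩
      ⟨⟨⟨a', b'⟩, ha', hb', hab'⟩, ⟨⟨c', d'⟩, hc', hd', hcd'⟩⟩ h
    have hdd : d = d' := congrArg (fun p => p.2.1) h
    simp only [Sigma.mk.injEq, Filt.mk.injEq] at h
    obtain ⟨⟨rfl, h₁, h₂⟩, -⟩ := h
    subst hdd
    have hb : b = b' := by
      ext s
      obtain ⟨r, rfl⟩ := hd s
      exact LinearMap.congr_fun h₁ r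
    have ha : a = a' := by
      ext n
      obtain ⟨r, hr⟩ := hd (a n)
      have : (r, n) ∈ LinearMap.eqLocus (d ∘ₗ LinearMap.fst A R N) (a' ∘ₗ LinearMap.snd A R N) := by
        rw [← h₂]; simpa [LinearMap.mem_eqLocus] using hr
      rw [← hr]
      simpa [LinearMap.mem_eqLocus] using this
    subst hb ha
    rfl
  · rintro ⟨z, d, hd, hk⟩
    have hk' : ∀ r, d r = 0 ↔ (r, 0) ∈ z.G := fun r => by
      rw [z.ker_iff]; exact SetLike.ext_iff.mp hk r
    obtain ⟨b, hb⟩ := exists_factor_of_surjective d z.q hd fun r hr =>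
      (z.dom_iff r).mp ⟨0, (hk' r).mp hr⟩
    obtain ⟨a, ha⟩ := exists_factor_of_surjective (LinearMap.snd A R N ∘ₗ z.G.subtype)
      (d ∘ₗ LinearMap.fst A R N ∘ₗ z.G.subtype)
      (fun n => (z.exists_left n).elim fun r hr => ⟨⟨(r, n), hr⟩, rfl⟩) (by
        rintro ⟨⟨r, n⟩, hr⟩ (rfl : n = 0)
        exact (hk' r).mpr hr)
    have ha' : ∀ r n, (r, n) ∈ z.G → a n = d r := fun r n h => ha ⟨(r, n), h⟩
    have hG : ∀ r n, d r = a n → (r, n) ∈ z.G := by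
      intro r n h
      obtain ⟨r', hr'⟩ := z.exists_left n
      have h0 : (r - r', 0) ∈ z.G := by
        rw [← hk', map_sub, h, ha' r' n hr', sub_self]
      simpa using z.G.add_mem h0 hr'
    have hainj : Injective a := by
      rw [injective_iff_map_eq_zero]
      intro n hn
      exact z.functional n (hG 0 n (by rw [hn, map_zero]))
    have hbsurj : Surjective b := fun m => by
      obtain ⟨r, rfl⟩ := z.q_surj m
      exact ⟨d r, hb r⟩
    have hab : LinearMap.range a = LinearMap.ker b := by
      ext s
      obtain ⟨r, rfl⟩ := hd s
      rw [LinearMap.mem_range, LinearMap.mem_ker, hb, ← z.dom_iff]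
      exact ⟨fun ⟨n, hn⟩ => ⟨n, hG r n hn.symm⟩, fun ⟨n, hn⟩ => ⟨n, ha' r n hn⟩⟩
    refine ⟨⟨⟨(a, b), hainj, hbsurj, hab⟩, ⟨(z.c, d), z.c_inj, hd, hk.symm⟩⟩, ?_⟩
    have hq : b ∘ₗ d = z.q := LinearMap.ext hb
    have hGG : LinearMap.eqLocus (d ∘ₗ LinearMap.fst A R N) (a ∘ₗ LinearMap.snd A R N) = z.G := by
      ext ⟨r, n⟩
      exact ⟨fun h => hG r n h, fun h => (ha' r n h).symm⟩
    obtain ⟨c, q, G, _, _, _, _, _, _⟩ := z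
    dsimp only at hq hGG
    subst hq hGG
    rfl

/-- Pairs of short exact sequences through a submodule `T` of `R` correspond to filtrations
of `R` together with an isomorphism of the middle step with `T`. -/
lemma hallP_mul_submodule [Finite M] [Finite N] [Finite Q] [Finite R]
    [Fintype (Filt A M N Q R)] (T : Type) [AddCommGroup T] [Module A T] [Finite T] :
    hallP A N Q T * hallP A M T R =
      ∑ z : Filt A M N Q R, Nat.card (LinearMap.ker z.q ≃ₗ[A] T) := by
  have hfin : Finite (T →ₗ[A] R) := Finite.of_injective _ DFunLike.coe_injective
  simp_rw [← card_injective_range_eq]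
  rw [← Nat.card_sigma, hallP, hallP, ← Nat.card_prod]
  refine Nat.card_eq_of_bijective (fun e => ⟨
    { c := e.2.1.1 ∘ₗ e.1.1.1
      q := e.2.1.2
      G := LinearMap.range (e.2.1.1.prod e.1.1.2)
      c_inj := e.2.2.1.comp e.1.2.1
      q_surj := e.2.2.2.1
      dom_iff := ?_
      exists_left := ?_
      functional := ?_
      ker_iff := ?_ }, ⟨e.2.1.1, e.2.2.1, e.2.2.2.2⟩⟩) ⟨?_, ?_⟩
  · intro r
    have := SetLike.ext_iff.mp e.2.2.2.2 r
    simp only [LinearMap.mem_range, LinearMap.mem_ker] at this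
    rw [← this]
    simp only [mem_range_prod]
    exact ⟨fun ⟨n, t, h, _⟩ => ⟨t, h⟩, fun ⟨t, h⟩ => ⟨_, t, h, rfl⟩⟩
  · intro n
    obtain ⟨t, rfl⟩ := e.1.2.2.1 n
    exact ⟨e.2.1.1 t, t, rfl⟩
  · intro n hn
    obtain ⟨t, ht⟩ := mem_range_prod.mp hn
    have : t = 0 := e.2.2.1 (by rw [ht.1, map_zero])
    rw [← ht.2, this, map_zero]
  · intro r
    simp only [mem_range_prod, LinearMap.comp_apply]
    have h : ∀ t, (∃ x, e.1.1.1 x = t) ↔ e.1.1.2 t = 0 := SetLike.ext_iff.mp e.1.2.2.2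
    simp_rw [← h]
    exact ⟨fun ⟨t, h, x, hx⟩ => ⟨x, by rw [hx, h]⟩, fun ⟨x, hx⟩ => ⟨_, hx, x, rfl⟩⟩
  · rintro ⟨⟨⟨a, b⟩, ha, hb, hab⟩, ⟨⟨c, d⟩, hc, hd, hcd⟩⟩
      ⟨⟨⟨a', b'⟩, ha', hb', hab'⟩, ⟨⟨c', d'⟩, hc', hd', hcd'⟩⟩ h
    have hcc : c = c' := congrArg (fun p => p.2.1) h
    simp only [Sigma.mk.injEq, Filt.mk.injEq] at h
    obtain ⟨⟨h₁, rfl, h₂⟩, -⟩ := h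
    subst hcc
    have ha : a = a' := by
      ext x
      exact hc (LinearMap.congr_fun h₁ x)
    have hb : b = b' := by
      ext t
      have : (c t, b t) ∈ LinearMap.range (c.prod b') := by
        rw [← h₂]; exact ⟨t, rfl⟩
      obtain ⟨t', ht'⟩ := mem_range_prod.mp this
      rw [← ht'.2, hc ht'.1]
    subst hb ha
    rfl
  · rintro ⟨z, c', hc', hr⟩
    have hr' : ∀ r, (∃ t, c' t = r) ↔ ∃ n, (r, n) ∈ z.G := fun r => by
      rw [z.dom_iff]; exact SetLike.ext_iff.mp hr r
    obtain ⟨a, ha⟩ := exists_factor_of_injective c' z.c hc' fun x =>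
      (hr' _).mpr ⟨0, (z.ker_iff _).mpr ⟨x, rfl⟩⟩
    obtain ⟨u, hu⟩ := exists_factor_of_injective c' (LinearMap.fst A R N ∘ₗ z.G.subtype) hc'
      fun g => (hr' _).mpr ⟨g.1.2, g.2⟩
    have husurj : Surjective u := fun t => by
      obtain ⟨n, hn⟩ := (hr' (c' t)).mp ⟨t, rfl⟩
      exact ⟨⟨(c' t, n), hn⟩, hc' (hu _)⟩
    obtain ⟨b, hb⟩ := exists_factor_of_surjective u (LinearMap.snd A R N ∘ₗ z.G.subtype) husurj (by
      rintro ⟨⟨r, n⟩, hg⟩ h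
      have hr0 : c' (u ⟨(r, n), hg⟩) = r := hu _
      rw [h, map_zero] at hr0
      subst hr0
      exact z.functional n hg)
    have hG : ∀ t n, (c' t, n) ∈ z.G → b t = n := fun t n hg => by
      have h₁ : u ⟨(c' t, n), hg⟩ = t := hc' (hu _)
      have h₂ := hb ⟨(c' t, n), hg⟩
      rwa [h₁] at h₂
    have hG' : ∀ t, (c' t, b t) ∈ z.G := fun t => by
      obtain ⟨n, hn⟩ := (hr' (c' t)).mp ⟨t, rfl⟩
      rwa [hG t n hn]
    have hainj : Injective a := fun x y h => z.c_inj (by rw [← ha, ← ha, h])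
    have hbsurj : Surjective b := fun n => by
      obtain ⟨r, hn⟩ := z.exists_left n
      obtain ⟨t, rfl⟩ := (hr' r).mpr ⟨n, hn⟩
      exact ⟨t, hG t n hn⟩
    have hab : LinearMap.range a = LinearMap.ker b := by
      ext t
      rw [LinearMap.mem_range, LinearMap.mem_ker]
      constructor
      · rintro ⟨x, rfl⟩
        exact hG _ 0 ((z.ker_iff _).mpr ⟨x, (ha x).symm⟩)
      · intro h
        have ht := hG' t
        rw [h, z.ker_iff] at ht
        obtain ⟨x, hx⟩ := ht
        exact ⟨x, hc' (by rw [ha, hx])⟩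
    refine ⟨⟨⟨(a, b), hainj, hbsurj, hab⟩, ⟨(c', z.q), hc', z.q_surj, hr⟩⟩, ?_⟩
    have hca : c' ∘ₗ a = z.c := LinearMap.ext ha
    have hGG : LinearMap.range (c'.prod b) = z.G := by
      ext ⟨r, n⟩
      constructor
      · rintro ⟨t, ht⟩
        rw [← ht]
        exact hG' t
      · intro h
        obtain ⟨t, rfl⟩ := (hr' r).mpr ⟨n, h⟩
        exact ⟨t, by simp [hG t n h]⟩
    obtain ⟨c, q, G, _, _, _, _, _, _⟩ := z
    dsimp only at hca hGG
    subst hca hGG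
    rfl

end HallCoassoc

/-- Coassociativity of Green's coproduct: for a finite ring `A`, finite `A`-modules
`M, N, Q, R`, and any complete irredundant family `V : ι → FinMod A` of representatives of
the isomorphism classes of finite `A`-modules,
`Σ_{[S]} (1/a_S)·P^S_{M,N}·P^R_{S,Q} = Σ_{[T]} (1/a_T)·P^T_{N,Q}·P^R_{M,T}` in `ℚ`,
both sums having finite support. -/
theorem green_coproduct_coassociative
    (A : Type) [Ring A] [Finite A]
    (M N Q R : Type)
    [AddCommGroup M] [Module A M] [Finite M]
    [AddCommGroup N] [Module A N] [Finite N]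
    [AddCommGroup Q] [Module A Q] [Finite Q]
    [AddCommGroup R] [Module A R] [Finite R]
    (ι : Type) (V : ι → FinMod A)
    (hrep : ∀ W : FinMod A, ∃! i : ι, Nonempty (W.carrier ≃ₗ[A] (V i).carrier)) :
    (Function.support fun i : ι =>
      (1 / (autCard A (V i).carrier : ℚ)) * (hallP A M N (V i).carrier : ℚ)
        * (hallP A (V i).carrier Q R : ℚ)).Finite ∧
    (Function.support fun i : ι =>
      (1 / (autCard A (V i).carrier : ℚ)) * (hallP A N Q (V i).carrier : ℚ)
        * (hallP A M (V i).carrier R : ℚ)).Finite ∧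
    (∑ᶠ i : ι, (1 / (autCard A (V i).carrier : ℚ)) * (hallP A M N (V i).carrier : ℚ)
        * (hallP A (V i).carrier Q R : ℚ))
      = (∑ᶠ i : ι, (1 / (autCard A (V i).carrier : ℚ)) * (hallP A N Q (V i).carrier : ℚ)
        * (hallP A M (V i).carrier R : ℚ)) := by
  have hquot (K : Submodule A R) : Finite (R ⧸ K) := Finite.of_surjective _ K.mkQ_surjective
  have : Fintype (HallCoassoc.Filt A M N Q R) := Fintype.ofFinite _
  obtain ⟨h₁, h₂⟩ := HallCoassoc.finsum_isomorphisms A V hrep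
    (fun z : HallCoassoc.Filt A M N Q R => ⟨R ⧸ LinearMap.range z.c⟩)
    (fun i => (1 / (autCard A (V i).carrier : ℚ)) * (hallP A M N (V i).carrier : ℚ)
        * (hallP A (V i).carrier Q R : ℚ))
    (fun i => by rw [mul_assoc, ← Nat.cast_mul, HallCoassoc.hallP_mul_quotient])
  obtain ⟨h₃, h₄⟩ := HallCoassoc.finsum_isomorphisms A V hrep
    (fun z : HallCoassoc.Filt A M N Q R => ⟨LinearMap.ker z.q⟩)
    (fun i => (1 / (autCard A (V i).carrier : ℚ)) * (hallP A N Q (V i).carrier : ℚ)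
        * (hallP A M (V i).carrier R : ℚ))
    (fun i => by rw [mul_assoc, ← Nat.cast_mul, HallCoassoc.hallP_mul_submodule])
  exact ⟨h₁, h₃, h₂.trans h₄.symm⟩
end

section
/- Let A be a ring and let M, N, R be finite A-modules. Call two short exact sequences 0 → N → E → M → 0 and 0 → N → E' → M → 0 equivalent if there is an A-module isomorphism φ : E → E' commuting with the given maps from N and to M. Then a_R times the number of equivalence classes of short exact sequences 0 → N → E → M → 0 whose middle term E is isomorphic to R equals |Hom_A(M,N)| · P^R_{M,N}. -/
/-- The type of short exact sequences `0 → N → E → M → 0` with arbitrary (finite) middle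
term `E`. -/
def ExtSeq (A : Type) [Ring A] (M N : Type)
    [AddCommGroup M] [Module A M] [AddCommGroup N] [Module A N] : Type 1 :=
  Σ E : FinMod A, {ab : (N →ₗ[A] E.carrier) × (E.carrier →ₗ[A] M) //
    Function.Injective ab.1 ∧ Function.Surjective ab.2 ∧
      LinearMap.range ab.1 = LinearMap.ker ab.2}

/-- Equivalence of short exact sequences: an isomorphism of the middle terms commuting with
the maps from `N` and to `M`. -/
def ExtSeqEquiv (A : Type) [Ring A] (M N : Type)
    [AddCommGroup M] [Module A M] [AddCommGroup N] [Module A N]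
    (s t : ExtSeq A M N) : Prop :=
  ∃ φ : s.1.carrier ≃ₗ[A] t.1.carrier,
    φ.toLinearMap ∘ₗ s.2.1.1 = t.2.1.1 ∧ t.2.1.2 ∘ₗ φ.toLinearMap = s.2.1.2

section ShortExactPairs

variable {A : Type} [Ring A] {M N R : Type}
  [AddCommGroup M] [Module A M] [AddCommGroup N] [Module A N] [AddCommGroup R] [Module A R]

variable (A M N R) in
/-- The type of short exact sequences `0 → N → R → M → 0` with fixed middle term `R`. -/
abbrev ShortExactPair : Type :=
  {ab : (N →ₗ[A] R) × (R →ₗ[A] M) //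
    Function.Injective ab.1 ∧ Function.Surjective ab.2 ∧
      LinearMap.range ab.1 = LinearMap.ker ab.2}

/-- Transport of a short exact sequence along an isomorphism of middle terms. -/
def ShortExactPair.map {E : Type} [AddCommGroup E] [Module A E] (g : E ≃ₗ[A] R)
    (s : ShortExactPair A M N E) : ShortExactPair A M N R :=
  ⟨(g.toLinearMap ∘ₗ s.1.1, s.1.2 ∘ₗ g.symm.toLinearMap),
    g.injective.comp s.2.1, s.2.2.1.comp g.symm.surjective, by
      ext x
      have h := SetLike.ext_iff.mp s.2.2.2 (g.symm x)
      simpa [LinearEquiv.eq_symm_apply] using h⟩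

/-- The automorphism group of the middle term acts on short exact sequences by transport. -/
instance ShortExactPair.instMulAction : MulAction (R ≃ₗ[A] R) (ShortExactPair A M N R) where
  smul g s := s.map g
  one_smul _ := rfl
  mul_smul _ _ _ := rfl

theorem ShortExactPair.smul_eq_iff (g : R ≃ₗ[A] R) (s t : ShortExactPair A M N R) :
    g • s = t ↔ g.toLinearMap ∘ₗ s.1.1 = t.1.1 ∧ t.1.2 ∘ₗ g.toLinearMap = s.1.2 := by
  have key : s.1.2 ∘ₗ g.symm.toLinearMap = t.1.2 ↔ t.1.2 ∘ₗ g.toLinearMap = s.1.2 := by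
    constructor
    · intro h
      rw [← h]
      ext x
      simp
    · intro h
      rw [← h]
      ext x
      simp
  rw [← key, Subtype.ext_iff, Prod.ext_iff]
  rfl

theorem ShortExactPair.apply_apply (s : ShortExactPair A M N R) (n : N) :
    s.1.2 (s.1.1 n) = 0 := by
  have h : s.1.1 n ∈ LinearMap.ker s.1.2 := s.2.2.2 ▸ LinearMap.mem_range_self s.1.1 n
  exact h

/-- The automorphism `x ↦ x + a (h (b x))` of the middle term of `0 → N → R → M → 0`
attached to a linear map `h : M → N`. -/
def ShortExactPair.shear (s : ShortExactPair A M N R) (h : M →ₗ[A] N) : R ≃ₗ[A] R :=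
  LinearEquiv.ofLinearMap (LinearMap.id + s.1.1 ∘ₗ h ∘ₗ s.1.2)
    (LinearMap.id - s.1.1 ∘ₗ h ∘ₗ s.1.2)
    (by ext x; simp [s.apply_apply]) (by ext x; simp [s.apply_apply])

theorem ShortExactPair.shear_apply (s : ShortExactPair A M N R) (h : M →ₗ[A] N) (x : R) :
    s.shear h x = x + s.1.1 (h (s.1.2 x)) := rfl

theorem ShortExactPair.shear_mem_stabilizer (s : ShortExactPair A M N R) (h : M →ₗ[A] N) :
    s.shear h ∈ MulAction.stabilizer (R ≃ₗ[A] R) s := by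
  rw [MulAction.mem_stabilizer_iff, ShortExactPair.smul_eq_iff]
  constructor <;> ext x <;> simp [s.shear_apply, s.apply_apply]

theorem ShortExactPair.shear_injective (s : ShortExactPair A M N R) :
    Function.Injective s.shear := by
  intro h k e
  ext m
  obtain ⟨x, rfl⟩ := s.2.2.1 m
  have := LinearEquiv.congr_fun e x
  simp only [s.shear_apply, add_right_inj] at this
  exact s.2.1 this

theorem ShortExactPair.exists_shear_eq (s : ShortExactPair A M N R) {g : R ≃ₗ[A] R}
    (hg : g ∈ MulAction.stabilizer (R ≃ₗ[A] R) s) : ∃ h, s.shear h = g := by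
  rw [MulAction.mem_stabilizer_iff, ShortExactPair.smul_eq_iff] at hg
  obtain ⟨hga, hbg⟩ := hg
  have mem_range (x : R) (hx : s.1.2 x = 0) : ∃ n, s.1.1 n = x := by
    have h : x ∈ LinearMap.range s.1.1 := s.2.2.2 ▸ hx
    exact h
  have exists_value (m : M) : ∃ n, ∀ x, s.1.2 x = m → g x = x + s.1.1 n := by
    obtain ⟨y, rfl⟩ := s.2.2.1 m
    obtain ⟨n, hn⟩ := mem_range (g y - y) (by
      rw [map_sub, sub_eq_zero]
      exact LinearMap.congr_fun hbg y)
    refine ⟨n, fun x hx => ?_⟩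
    obtain ⟨k, hk⟩ := mem_range (x - y) (by rw [map_sub, hx, sub_self])
    have hgk : g (x - y) = x - y := by
      rw [← hk]
      exact LinearMap.congr_fun hga k
    rw [map_sub, sub_eq_iff_eq_add] at hgk
    rw [hgk, hn]
    abel
  choose h hh using exists_value
  refine ⟨{ toFun := h, map_add' := fun m m' => ?_, map_smul' := fun r m => ?_ }, ?_⟩
  · obtain ⟨x, rfl⟩ := s.2.2.1 m
    obtain ⟨y, rfl⟩ := s.2.2.1 m'
    apply s.2.1
    have := hh _ (x + y) (map_add _ x y)
    rw [map_add, hh _ x rfl, hh _ y rfl, add_add_add_comm, add_right_inj] at this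
    rw [← this, map_add]
  · obtain ⟨x, rfl⟩ := s.2.2.1 m
    apply s.2.1
    have := hh _ (r • x) (map_smul _ r x)
    rw [map_smul, hh _ x rfl, smul_add, add_right_inj] at this
    rw [← this, RingHom.id_apply, map_smul]
  · ext x
    exact (hh _ x rfl).symm

/-- The stabilizer of `0 → N → R → M → 0` in the automorphism group of `R` is in bijection with
the linear maps `M → N`. -/
noncomputable def ShortExactPair.homEquivStabilizer (s : ShortExactPair A M N R) :
    (M →ₗ[A] N) ≃ MulAction.stabilizer (R ≃ₗ[A] R) s :=
  Equiv.ofBijective (fun h => ⟨s.shear h, s.shear_mem_stabilizer h⟩)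
    ⟨fun _ _ e => s.shear_injective (congrArg Subtype.val e),
      fun g => (s.exists_shear_eq g.2).imp fun _ => Subtype.ext⟩

variable (A M N R) in
/-- Pairs consisting of an orbit and an automorphism correspond to pairs consisting of a short
exact sequence and a linear map `M → N`. -/
noncomputable def ShortExactPair.orbitsProdAutEquiv :
    MulAction.orbitRel.Quotient (R ≃ₗ[A] R) (ShortExactPair A M N R) × (R ≃ₗ[A] R) ≃
      ShortExactPair A M N R × (M →ₗ[A] N) :=
  calc
    _ ≃ Σ g : R ≃ₗ[A] R, MulAction.fixedBy (ShortExactPair A M N R) g :=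
      (MulAction.sigmaFixedByEquivOrbitsProdGroup _ _).symm
    _ ≃ Σ s : ShortExactPair A M N R, MulAction.stabilizer (R ≃ₗ[A] R) s :=
      { toFun := fun p => ⟨p.2.1, p.1, p.2.2⟩
        invFun := fun p => ⟨p.2.1, p.1, p.2.2⟩
        left_inv := fun _ => rfl
        right_inv := fun _ => rfl }
    _ ≃ Σ _ : ShortExactPair A M N R, (M →ₗ[A] N) :=
      Equiv.sigmaCongrRight fun s => s.homEquivStabilizer.symm
    _ ≃ _ := Equiv.sigmaEquivProd _ _

variable (A M N) in
theorem equivalence_extSeqEquiv : Equivalence (ExtSeqEquiv A M N) where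
  refl s := ⟨LinearEquiv.refl A _, rfl, rfl⟩
  symm := by
    rintro s t ⟨φ, h₁, h₂⟩
    refine ⟨φ.symm, ?_, ?_⟩
    · rw [← h₁]
      ext x
      simp
    · rw [← h₂]
      ext x
      simp
  trans := by
    rintro s t u ⟨φ, h₁, h₂⟩ ⟨ψ, k₁, k₂⟩
    refine ⟨φ.trans ψ, ?_, ?_⟩
    · rw [← k₁, ← h₁]
      rfl
    · rw [← h₂, ← k₂]
      rfl

/-- A short exact sequence with finite middle term `R`, viewed in the type of all of them. -/
def ShortExactPair.toExtSeq [Finite R] (s : ShortExactPair A M N R) : ExtSeq A M N :=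
  ⟨⟨R⟩, s⟩

theorem ShortExactPair.extSeqEquiv_toExtSeq_iff [Finite R] (s t : ShortExactPair A M N R) :
    ExtSeqEquiv A M N s.toExtSeq t.toExtSeq ↔ ∃ g : R ≃ₗ[A] R, g • s = t :=
  exists_congr fun g => (ShortExactPair.smul_eq_iff g s t).symm

theorem ExtSeq.extSeqEquiv_toExtSeq_map [Finite R] (s : ExtSeq A M N)
    (g : s.1.carrier ≃ₗ[A] R) :
    ExtSeqEquiv A M N s (ShortExactPair.map g s.2).toExtSeq := by
  refine ⟨g, rfl, ?_⟩
  ext x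
  exact congrArg s.2.1.2 (g.symm_apply_apply x)

variable (A M N R) in
/-- Orbits of short exact sequences with middle term `R` correspond to equivalence classes of
short exact sequences with middle term isomorphic to `R`. -/
noncomputable def ShortExactPair.orbitsEquivClasses [Finite R] :
    MulAction.orbitRel.Quotient (R ≃ₗ[A] R) (ShortExactPair A M N R) ≃
      {c : Quot (ExtSeqEquiv A M N) //
        ∃ s : ExtSeq A M N, Quot.mk (ExtSeqEquiv A M N) s = c ∧
          Nonempty (s.1.carrier ≃ₗ[A] R)} :=
  have eq_iff (s t : ShortExactPair A M N R) :
      Quot.mk (ExtSeqEquiv A M N) s.toExtSeq = Quot.mk _ t.toExtSeq ↔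
        MulAction.orbitRel (R ≃ₗ[A] R) _ s t := by
    rw [(equivalence_extSeqEquiv A M N).quot_mk_eq_iff]
    exact (extSeqEquiv_toExtSeq_iff s t).trans
      (MulAction.mem_orbit_symm (G := R ≃ₗ[A] R) (a₁ := t) (a₂ := s))
  Equiv.ofBijective
    (Quotient.lift
      (fun s => ⟨Quot.mk _ s.toExtSeq, s.toExtSeq, rfl, ⟨LinearEquiv.refl A R⟩⟩)
      fun s t h => Subtype.ext ((eq_iff s t).mpr h))
    ⟨by
      rintro ⟨s⟩ ⟨t⟩ h
      exact Quotient.sound ((eq_iff s t).mp (congrArg Subtype.val h)), by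
      rintro ⟨_, s, rfl, ⟨g⟩⟩
      exact ⟨Quotient.mk _ (ShortExactPair.map g s.2),
        Subtype.ext (Quot.sound (s.extSeqEquiv_toExtSeq_map g)).symm⟩⟩

end ShortExactPairs

/-- For finite modules `M, N, R` over a ring `A`: `a_R` times the number of equivalence
classes of short exact sequences `0 → N → E → M → 0` whose middle term `E` is isomorphic
to `R` equals `|Hom_A(M,N)| · P^R_{M,N}`. -/
theorem card_equivClasses_of_extensions
    (A : Type) [Ring A]
    (M N R : Type)
    [AddCommGroup M] [Module A M] [Finite M]
    [AddCommGroup N] [Module A N] [Finite N]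
    [AddCommGroup R] [Module A R] [Finite R] :
    autCard A R *
        Nat.card {c : Quot (ExtSeqEquiv A M N) //
          ∃ s : ExtSeq A M N, Quot.mk (ExtSeqEquiv A M N) s = c ∧
            Nonempty (s.1.carrier ≃ₗ[A] R)}
      = Nat.card (M →ₗ[A] N) * hallP A M N R := by
  unfold autCard hallP
  rw [← Nat.card_congr (ShortExactPair.orbitsEquivClasses A M N R), mul_comm, ← Nat.card_prod,
    Nat.card_congr (ShortExactPair.orbitsProdAutEquiv A M N R), Nat.card_prod, mul_comm]
end

section
/- (Green's formula.) Let A be a finite ring which is hereditary in the sense that Ext²_A(X,Y) = 0 for all finite A-modules X and Y. Then for all finite A-modules M, N, K, L the following equality of rational numbers holds: Σ_{[J]} (1/a_J) · P^J_{M,N} · P^J_{K,L} = Σ_{[K₁],[K₂],[L₁],[L₂]} (|Ext¹_A(K₂,L₁)| / |Hom_A(K₂,L₁)|) · P^K_{K₂,K₁} · P^L_{L₂,L₁} · P^M_{K₂,L₂} · P^N_{K₁,L₁} / (a_{K₁} · a_{K₂} · a_{L₁} · a_{L₂}), where the left sum ranges over isomorphism classes of finite A-modules, the right sum over quadruples of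 such classes, and both have only finitely many nonzero terms. This identity is the combinatorial core of Green's theorem that the Hall coproduct is an algebra homomorphism. -/
open CategoryTheory

universe w

section Ext

variable {A : Type} [Ring A] [HasExt.{w} (ModuleCat A)]

/-- A projective presentation `P → Q` with kernel `Ω` computes `Ext¹(Q, Y)` up to cardinality. -/
theorem card_ext_one_mul_card_hom {P Q Y : Type} [AddCommGroup P] [Module A P]
    [Module.Projective A P] [AddCommGroup Q] [Module A Q] [AddCommGroup Y] [Module A Y]
    {π : P →ₗ[A] Q} (hπ : Function.Surjective π) :
    Nat.card (Abelian.Ext (ModuleCat.of A Q) (ModuleCat.of A Y) 1) * Nat.card (P →ₗ[A] Y)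
      = Nat.card (Q →ₗ[A] Y) * Nat.card (LinearMap.ker π →ₗ[A] Y) := by
  have hS := LinearMap.shortExact_shortComplexKer hπ
  let res : (P →ₗ[A] Y) →+ (LinearMap.ker π →ₗ[A] Y) :=
    { toFun := fun f => f ∘ₗ (LinearMap.ker π).subtype
      map_zero' := rfl
      map_add' := fun _ _ => rfl }
  let infl : (Q →ₗ[A] Y) →+ (P →ₗ[A] Y) :=
    { toFun := fun f => f ∘ₗ π
      map_zero' := rfl
      map_add' := fun _ _ => rfl }
  let δ : (LinearMap.ker π →ₗ[A] Y) →+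
      Abelian.Ext (ModuleCat.of A Q) (ModuleCat.of A Y) 1 :=
    { toFun := fun f => hS.extClass.comp (Abelian.Ext.mk₀ (ModuleCat.ofHom f)) (add_zero 1)
      map_zero' := by
        rw [ModuleCat.ofHom_zero, Abelian.Ext.mk₀_zero, Abelian.Ext.comp_zero]
      map_add' := fun f g => by
        rw [ModuleCat.ofHom_add, Abelian.Ext.mk₀_add, Abelian.Ext.comp_add] }
  have hinfl : Function.Injective infl := fun f g h =>
    LinearMap.ext fun q => by
      obtain ⟨p, rfl⟩ := hπ q
      exact LinearMap.congr_fun h p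
  have hres : res.ker = infl.range := by
    ext f
    constructor
    · intro hf
      have hf' : LinearMap.ker π ≤ LinearMap.ker f := fun x hx =>
        LinearMap.congr_fun (AddMonoidHom.mem_ker.1 hf) ⟨x, hx⟩
      let e := π.quotKerEquivOfSurjective hπ
      refine ⟨(LinearMap.ker π).liftQ f hf' ∘ₗ e.symm.toLinearMap, ?_⟩
      ext p
      have : e.symm (π p) = (LinearMap.ker π).mkQ p := by
        rw [LinearEquiv.symm_apply_eq]; rfl
      change (LinearMap.ker π).liftQ f hf' (e.symm (π p)) = f p
      rw [this]; rfl
    · rintro ⟨g, rfl⟩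
      refine AddMonoidHom.mem_ker.2 (LinearMap.ext fun x => ?_)
      change g (π x) = 0
      rw [x.2, map_zero]
  have hδ : δ.ker = res.range := by
    ext f
    constructor
    · intro hf
      obtain ⟨x, hx⟩ := Abelian.Ext.contravariant_sequence_exact₁ hS (ModuleCat.of A Y)
        (Abelian.Ext.mk₀ (ModuleCat.ofHom f)) (add_zero 1) hf
      obtain ⟨g, rfl⟩ := (Abelian.Ext.mk₀_bijective _ _).2 x
      rw [Abelian.Ext.mk₀_comp_mk₀] at hx
      refine ⟨g.hom, ?_⟩
      have := (Abelian.Ext.mk₀_bijective _ _).1 hx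
      exact congrArg ModuleCat.Hom.hom this
    · rintro ⟨g, rfl⟩
      refine AddMonoidHom.mem_ker.2 ?_
      change hS.extClass.comp (Abelian.Ext.mk₀ (ModuleCat.ofHom
        (g ∘ₗ (LinearMap.ker π).subtype))) (add_zero 1) = 0
      rw [ModuleCat.ofHom_comp, ← Abelian.Ext.mk₀_comp_mk₀]
      exact hS.extClass_comp_assoc _
  have hδs : Function.Surjective δ := fun x => by
    have : Projective (ModuleCat.of A P) := (IsProjective.iff_projective P).1 inferInstance
    obtain ⟨y, rfl⟩ := Abelian.Ext.contravariant_sequence_exact₃ hS (ModuleCat.of A Y) x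
      (Abelian.Ext.eq_zero_of_projective _) (add_zero 1)
    obtain ⟨g, rfl⟩ := (Abelian.Ext.mk₀_bijective _ _).2 y
    exact ⟨g.hom, rfl⟩
  have h1 := AddSubgroup.card_mul_index res.ker
  have h2 := AddSubgroup.card_mul_index δ.ker
  rw [AddSubgroup.index_ker] at h1 h2
  rw [AddMonoidHom.range_eq_top.2 hδs, AddSubgroup.card_top, hδ] at h2
  rw [hres, ← Nat.card_congr (AddMonoidHom.ofInjective hinfl).toEquiv] at h1
  rw [← h1, ← h2]
  ring

/-- If `Ext²(Q, ker g) = 0`, then maps out of the kernel of a projective presentation of `Q` lift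
along the surjection `g`. -/
theorem exists_lift_of_ext_two {P Q Y Z : Type} [AddCommGroup P] [Module A P]
    [Module.Projective A P] [AddCommGroup Q] [Module A Q] [AddCommGroup Y] [Module A Y]
    [AddCommGroup Z] [Module A Z]
    {π : P →ₗ[A] Q} (hπ : Function.Surjective π) {g : Y →ₗ[A] Z} (hg : Function.Surjective g)
    (h2 : Subsingleton (Abelian.Ext (ModuleCat.of A Q) (ModuleCat.of A (LinearMap.ker g)) 2))
    (f : LinearMap.ker π →ₗ[A] Z) : ∃ f' : LinearMap.ker π →ₗ[A] Y, g ∘ₗ f' = f := by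
  have hS := LinearMap.shortExact_shortComplexKer hπ
  have hT := LinearMap.shortExact_shortComplexKer hg
  have : Projective (ModuleCat.of A P) := (IsProjective.iff_projective P).1 inferInstance
  have h1 : ∀ x : Abelian.Ext (ModuleCat.of A (LinearMap.ker π))
      (ModuleCat.of A (LinearMap.ker g)) 1, x = 0 := fun x => by
    obtain ⟨y, rfl⟩ := Abelian.Ext.contravariant_sequence_exact₁ hS _ x (n₁ := 2) rfl
      (Subsingleton.elim (α := Abelian.Ext (ModuleCat.of A Q)
        (ModuleCat.of A (LinearMap.ker g)) 2) _ _)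
    rw [Abelian.Ext.eq_zero_of_projective y, Abelian.Ext.comp_zero]
  obtain ⟨x, hx⟩ := Abelian.Ext.covariant_sequence_exact₃ (ModuleCat.of A (LinearMap.ker π)) hT
    (Abelian.Ext.mk₀ (ModuleCat.ofHom f)) (zero_add 1) (h1 _)
  obtain ⟨f', rfl⟩ := (Abelian.Ext.mk₀_bijective _ _).2 x
  rw [Abelian.Ext.mk₀_comp_mk₀] at hx
  exact ⟨f'.hom, congrArg ModuleCat.Hom.hom ((Abelian.Ext.mk₀_bijective _ _).1 hx)⟩

end Ext

section Glue

variable {A : Type} [Ring A] {U N L J : Type} [AddCommGroup U] [Module A U]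
  [AddCommGroup N] [Module A N] [AddCommGroup L] [Module A L] [AddCommGroup J] [Module A J]

/-- The pushout of `i : U → N` and `j : U → L`. -/
abbrev Glue (i : U →ₗ[A] N) (j : U →ₗ[A] L) : Type :=
  (N × L) ⧸ LinearMap.range (i.prod (-j))

namespace Glue

variable (i : U →ₗ[A] N) (j : U →ₗ[A] L)

/-- The left inclusion into the pushout. -/
def inl : N →ₗ[A] Glue i j := Submodule.mkQ _ ∘ₗ LinearMap.inl A N L

/-- The right inclusion into the pushout. -/
def inr : L →ₗ[A] Glue i j := Submodule.mkQ _ ∘ₗ LinearMap.inr A N L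

variable {i j}

theorem inl_add_inr_eq_mk (n : N) (l : L) :
    inl i j n + inr i j l = Submodule.Quotient.mk (n, l) := by
  simp [inl, inr, ← Submodule.Quotient.mk_add]

theorem exists_eq (x : Glue i j) : ∃ n l, x = inl i j n + inr i j l := by
  obtain ⟨⟨n, l⟩, rfl⟩ := Submodule.Quotient.mk_surjective _ x
  exact ⟨n, l, (inl_add_inr_eq_mk n l).symm⟩

theorem inl_add_inr_eq_zero {n : N} {l : L} :
    inl i j n + inr i j l = 0 ↔ ∃ u, i u = n ∧ -j u = l := by
  rw [inl_add_inr_eq_mk, Submodule.Quotient.mk_eq_zero]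
  simp [LinearMap.mem_range, Prod.ext_iff]

theorem condition (u : U) : inl i j (i u) = inr i j (j u) := by
  rw [← sub_eq_zero, sub_eq_add_neg, ← map_neg, inl_add_inr_eq_zero]
  exact ⟨u, rfl, rfl⟩

/-- The map out of the pushout given by a commutative square. -/
def desc (a : N →ₗ[A] J) (b : L →ₗ[A] J) (h : ∀ u, a (i u) = b (j u)) : Glue i j →ₗ[A] J :=
  Submodule.liftQ _ (a.coprod b) (by
    rintro _ ⟨u, rfl⟩
    simp [h])

@[simp]
theorem desc_inl (a : N →ₗ[A] J) (b : L →ₗ[A] J) (h : ∀ u, a (i u) = b (j u)) (n : N) :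
    desc a b h (inl i j n) = a n := by
  simp [desc, inl]

@[simp]
theorem desc_inr (a : N →ₗ[A] J) (b : L →ₗ[A] J) (h : ∀ u, a (i u) = b (j u)) (l : L) :
    desc a b h (inr i j l) = b l := by
  simp [desc, inr]

theorem hom_ext {f g : Glue i j →ₗ[A] J} (hl : ∀ n, f (inl i j n) = g (inl i j n))
    (hr : ∀ l, f (inr i j l) = g (inr i j l)) : f = g := by
  refine LinearMap.ext fun x => ?_
  obtain ⟨n, l, rfl⟩ := exists_eq x
  simp [hl, hr]

theorem inl_injective (hj : Function.Injective j) : Function.Injective (inl i j) := by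
  rw [← LinearMap.ker_eq_bot, LinearMap.ker_eq_bot']
  intro n hn
  obtain ⟨u, rfl, hu⟩ := inl_add_inr_eq_zero.1 (show inl i j n + inr i j 0 = 0 by simpa using hn)
  rw [hj (show j u = j 0 by simpa using hu), map_zero]

instance [Finite N] [Finite L] : Finite (Glue i j) :=
  Quotient.finite _

end Glue

end Glue

section Counting

variable {A : Type} [Ring A]

instance {M N : Type} [AddCommGroup M] [Module A M] [Finite M] [AddCommGroup N] [Module A N]
    [Finite N] : Finite (M →ₗ[A] N) :=
  DFunLike.finite _

instance {M N : Type} [AddCommGroup M] [Module A M] [Finite M] [AddCommGroup N] [Module A N]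
    [Finite N] : Finite (M ≃ₗ[A] N) :=
  DFunLike.finite _

theorem autCard_ne_zero (M : FinMod A) : (autCard A M.carrier : ℚ) ≠ 0 := by
  have : Nat.card (M.carrier ≃ₗ[A] M.carrier) ≠ 0 := Nat.card_pos.ne'
  exact_mod_cast this

/-- The lifts of a linear map along `β` are a torsor under the maps into the kernel of `β`. -/
theorem card_lifts {P J X Z : Type} [AddCommGroup P] [Module A P] [AddCommGroup J] [Module A J]
    [AddCommGroup X] [Module A X] [AddCommGroup Z] [Module A Z]
    {β : J →ₗ[A] X} {κ : Z →ₗ[A] J} (hκ : Function.Injective κ)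
    (h : LinearMap.range κ = LinearMap.ker β) {p : P →ₗ[A] X} {h₀ : P →ₗ[A] J}
    (hh₀ : β ∘ₗ h₀ = p) :
    Nat.card {h : P →ₗ[A] J // β ∘ₗ h = p} = Nat.card (P →ₗ[A] Z) := by
  have hβκ : ∀ z, β (κ z) = 0 := fun z => by
    rw [← LinearMap.mem_ker, ← h]
    exact ⟨z, rfl⟩
  refine (Nat.card_congr (Equiv.ofBijective
    (fun u : P →ₗ[A] Z => (⟨h₀ + κ ∘ₗ u, ?_⟩ : {h : P →ₗ[A] J // β ∘ₗ h = p})) ⟨?_, ?_⟩)).symm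
  · rw [← hh₀]
    ext x
    simp [hβκ]
  · intro u v huv
    ext x
    have := LinearMap.congr_fun (congrArg Subtype.val huv) x
    exact hκ (by simpa using this)
  · rintro ⟨g, hg⟩
    have hm : ∀ x, (g - h₀) x ∈ LinearMap.range κ := fun x => by
      rw [h, LinearMap.mem_ker, LinearMap.sub_apply, map_sub, sub_eq_zero]
      exact LinearMap.congr_fun (hg.trans hh₀.symm) x
    refine ⟨(LinearEquiv.ofInjective κ hκ).symm.toLinearMap ∘ₗ (g - h₀).codRestrict _ hm, ?_⟩
    refine Subtype.ext (LinearMap.ext fun x => ?_)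
    have : κ ((LinearEquiv.ofInjective κ hκ).symm ((g - h₀).codRestrict _ hm x))
        = (g - h₀) x :=
      congrArg Subtype.val ((LinearEquiv.ofInjective κ hκ).apply_symm_apply _)
    simp [this]

variable {ι : Type} {V : ι → FinMod A}

theorem card_linearEquiv_eq
    (hrep : ∀ W : FinMod A, ∃! i : ι, Nonempty (W.carrier ≃ₗ[A] (V i).carrier))
    (W : FinMod A) : ∃ i : ι,
    (Nat.card (W.carrier ≃ₗ[A] (V i).carrier) : ℚ) / autCard A (V i).carrier = 1 ∧
    ∀ j, j ≠ i →
      (Nat.card (W.carrier ≃ₗ[A] (V j).carrier) : ℚ) / autCard A (V j).carrier = 0 := by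
  obtain ⟨i, ⟨e⟩, hi⟩ := hrep W
  refine ⟨i, ?_, fun j hj => ?_⟩
  · have : Nat.card (W.carrier ≃ₗ[A] (V i).carrier) = autCard A (V i).carrier :=
      Nat.card_congr
        { toFun := fun f => e.symm.trans f
          invFun := fun f => e.trans f
          left_inv := fun f => by ext; simp
          right_inv := fun f => by ext; simp }
    rw [this, div_self (autCard_ne_zero _)]
  · have : IsEmpty (W.carrier ≃ₗ[A] (V j).carrier) :=
      ⟨fun f => hj (hi j ⟨f⟩)⟩
    simp

theorem support_card_linearEquiv
    (hrep : ∀ W : FinMod A, ∃! i : ι, Nonempty (W.carrier ≃ₗ[A] (V i).carrier))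
    (W : FinMod A) : (Function.support fun i : ι =>
    (Nat.card (W.carrier ≃ₗ[A] (V i).carrier) : ℚ) / autCard A (V i).carrier).Finite := by
  obtain ⟨i, -, hi⟩ := card_linearEquiv_eq hrep W
  refine (Set.finite_singleton i).subset fun j hj => ?_
  by_contra h
  exact hj (hi j h)

/-- The groupoid of modules isomorphic to `W` together with an isomorphism has mass one. -/
theorem finsum_card_linearEquiv
    (hrep : ∀ W : FinMod A, ∃! i : ι, Nonempty (W.carrier ≃ₗ[A] (V i).carrier))
    (W : FinMod A) : ∑ᶠ i : ι,
    (Nat.card (W.carrier ≃ₗ[A] (V i).carrier) : ℚ) / autCard A (V i).carrier = 1 := by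
  obtain ⟨i, h, hi⟩ := card_linearEquiv_eq hrep W
  rw [finsum_eq_single _ i hi, h]

end Counting

section Factorization

variable {A : Type} [Ring A] {Y X : Type} [AddCommGroup Y] [Module A Y]
  [AddCommGroup X] [Module A X]

/-- Factorizations `Y ↪ J ↠ X` of `φ` for which `ker (J → X)` is the image of `ker φ`. -/
abbrev Factorization (φ : Y →ₗ[A] X) (J : Type) [AddCommGroup J] [Module A J] : Type :=
  {c : (Y →ₗ[A] J) × (J →ₗ[A] X) // Function.Injective c.1 ∧ Function.Surjective c.2 ∧
    (∀ y, c.2 (c.1 y) = φ y) ∧ LinearMap.ker c.2 ≤ LinearMap.range c.1}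

variable {φ : Y →ₗ[A] X} {P Q : Type} [AddCommGroup P] [Module A P] [AddCommGroup Q] [Module A Q]
  {ψ : X →ₗ[A] Q} {p : P →ₗ[A] X}

theorem card_sigma_factorization_lift {Z J : Type} [AddCommGroup Z] [Module A Z]
    [AddCommGroup J] [Module A J] [Finite Y] [Finite X] [Finite J] [Finite P]
    [Module.Projective A P] {κ : Z →ₗ[A] Y}
    (hκ : Function.Injective κ) (hκφ : LinearMap.range κ = LinearMap.ker φ) :
    Nat.card (Σ c : Factorization φ J, {h : P →ₗ[A] J // c.1.2 ∘ₗ h = p})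
      = Nat.card (Factorization φ J) * Nat.card (P →ₗ[A] Z) := by
  have := Fintype.ofFinite (Factorization φ J)
  rw [Nat.card_sigma, Finset.sum_congr rfl fun c _ => ?_, Finset.sum_const, Finset.card_univ,
    smul_eq_mul, Nat.card_eq_fintype_card]
  obtain ⟨⟨α, β⟩, hα, hβ, hαβ, hk⟩ := c
  dsimp only at hα hβ hαβ hk ⊢
  obtain ⟨h₀, hh₀⟩ := Module.projective_lifting_property β p hβ
  refine card_lifts (κ := α ∘ₗ κ) (hα.comp hκ) ?_ hh₀
  ext x
  constructor
  · rintro ⟨z, rfl⟩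
    have : κ z ∈ LinearMap.ker φ := hκφ ▸ ⟨z, rfl⟩
    simpa [hαβ] using this
  · intro hx
    obtain ⟨y, rfl⟩ := hk hx
    have hy : y ∈ LinearMap.ker φ := by simpa [hαβ] using hx
    obtain ⟨z, rfl⟩ := hκφ ▸ hy
    exact ⟨z, rfl⟩

/-- A factorization of `φ` through `J` together with a lift of `p : P → X` to `J` is the same as
an isomorphism to `J` from the pushout along `ker (P → X → Q)`. -/
theorem card_sigma_factorization_eq {J : Type} [AddCommGroup J] [Module A J]
    (hφψ : LinearMap.range φ = LinearMap.ker ψ) (hψp : Function.Surjective (ψ ∘ₗ p)) :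
    Nat.card (Σ c : Factorization φ J, {h : P →ₗ[A] J // c.1.2 ∘ₗ h = p})
      = Nat.card (Σ f : {f : LinearMap.ker (ψ ∘ₗ p) →ₗ[A] Y //
          φ ∘ₗ f = p ∘ₗ (LinearMap.ker (ψ ∘ₗ p)).subtype},
        Glue f.1 (LinearMap.ker (ψ ∘ₗ p)).subtype ≃ₗ[A] J) := by
  have hψφ : ∀ y, ψ (φ y) = 0 := fun y => by
    rw [← LinearMap.mem_ker, ← hφψ]
    exact ⟨y, rfl⟩
  symm
  refine Nat.card_congr (Equiv.ofBijective (fun fe =>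
    ⟨⟨(fe.2.toLinearMap ∘ₗ Glue.inl _ _,
        Glue.desc φ p (fun u => LinearMap.congr_fun fe.1.2 u) ∘ₗ fe.2.symm.toLinearMap),
      ?_, ?_, ?_, ?_⟩, fe.2.toLinearMap ∘ₗ Glue.inr _ _, ?_⟩) ⟨?_, ?_⟩)
  · exact fe.2.injective.comp (Glue.inl_injective (Submodule.injective_subtype _))
  · intro x
    obtain ⟨q, hq⟩ := hψp (ψ x)
    obtain ⟨y, hy⟩ : x - p q ∈ LinearMap.range φ := by
      rw [hφψ, LinearMap.mem_ker, map_sub, sub_eq_zero]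
      exact hq.symm
    exact ⟨fe.2 (Glue.inl _ _ y + Glue.inr _ _ q), by simp [hy]⟩
  · intro y
    simp
  · intro x hx
    obtain ⟨x, rfl⟩ := fe.2.surjective x
    obtain ⟨y, q, rfl⟩ := Glue.exists_eq x
    have hx' : φ y + p q = 0 := by simpa using hx
    have hq : q ∈ LinearMap.ker (ψ ∘ₗ p) := by
      have := congrArg ψ hx'
      simpa [hψφ] using this
    refine ⟨y + fe.1.1 ⟨q, hq⟩, ?_⟩
    have := Glue.condition (i := fe.1.1) (j := (LinearMap.ker (ψ ∘ₗ p)).subtype) ⟨q, hq⟩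
    simp [this]
  · ext x
    simp
  · rintro ⟨⟨f, hf⟩, e⟩ ⟨⟨f', hf'⟩, e'⟩ h
    have hl : ∀ y, e (Glue.inl _ _ y) = e' (Glue.inl _ _ y) :=
      LinearMap.congr_fun (congrArg (fun s => s.1.1.1) h)
    have hr : ∀ q, e (Glue.inr _ _ q) = e' (Glue.inr _ _ q) :=
      LinearMap.congr_fun (congrArg (fun s => s.2.1) h)
    obtain rfl : f = f' := LinearMap.ext fun u => by
      refine Glue.inl_injective (i := f) (Submodule.injective_subtype _) (e.injective ?_)
      rw [Glue.condition, hr, hl, Glue.condition]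
    obtain rfl : e = e' := LinearEquiv.toLinearMap_injective (Glue.hom_ext hl hr)
    rfl
  · rintro ⟨⟨⟨α, β⟩, hα, hβ, hαβ, hk⟩, h, hh⟩
    dsimp only at hα hβ hαβ hk hh
    have hβh : ∀ q, β (h q) = p q := LinearMap.congr_fun hh
    have hm : ∀ u, (h ∘ₗ (LinearMap.ker (ψ ∘ₗ p)).subtype) u ∈ LinearMap.range α := fun u => by
      obtain ⟨y, hy⟩ : p u ∈ LinearMap.range φ := by
        rw [hφψ]
        exact u.2
      obtain ⟨y', hy'⟩ := hk (show h u - α y ∈ LinearMap.ker β by simp [hαβ, hβh, hy])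
      exact ⟨y' + y, by simp [hy']⟩
    let f : LinearMap.ker (ψ ∘ₗ p) →ₗ[A] Y := (LinearEquiv.ofInjective α hα).symm.toLinearMap ∘ₗ
      (h ∘ₗ (LinearMap.ker (ψ ∘ₗ p)).subtype).codRestrict _ hm
    have hf : ∀ u, α (f u) = h u := fun u =>
      congrArg Subtype.val ((LinearEquiv.ofInjective α hα).apply_symm_apply _)
    let g : Glue f (LinearMap.ker (ψ ∘ₗ p)).subtype →ₗ[A] J := Glue.desc α h hf
    have gl : ∀ y, g (Glue.inl _ _ y) = α y := fun y => Glue.desc_inl _ _ _ y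
    have gr : ∀ q, g (Glue.inr _ _ q) = h q := fun q => Glue.desc_inr _ _ _ q
    have hg : Function.Bijective g := by
      constructor
      · rw [← LinearMap.ker_eq_bot, LinearMap.ker_eq_bot']
        intro x hx
        obtain ⟨y, q, rfl⟩ := Glue.exists_eq x
        have hx' : α y + h q = 0 := by simpa [gl, gr] using hx
        have hq : q ∈ LinearMap.ker (ψ ∘ₗ p) := by
          have := congrArg (fun j => ψ (β j)) hx'
          simpa [hαβ, hβh, hψφ] using this
        refine Glue.inl_add_inr_eq_zero.2 ⟨-⟨q, hq⟩, hα ?_, by simp⟩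
        rw [map_neg, map_neg, hf]
        exact (eq_neg_of_add_eq_zero_left hx').symm
      · intro j
        obtain ⟨q, hq⟩ := hψp (ψ (β j))
        obtain ⟨y, hy⟩ : β j - p q ∈ LinearMap.range φ := by
          rw [hφψ, LinearMap.mem_ker, map_sub, sub_eq_zero]
          exact hq.symm
        obtain ⟨y', hy'⟩ := hk (show j - h q - α y ∈ LinearMap.ker β by simp [hαβ, hβh, hy])
        refine ⟨Glue.inl _ _ (y' + y) + Glue.inr _ _ q, ?_⟩
        simp [gl, gr, hy']
    let e := LinearEquiv.ofBijective g hg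
    have hφf : ∀ u, φ (f u) = p ((LinearMap.ker (ψ ∘ₗ p)).subtype u) := fun u => by
      rw [← hαβ, hf, hβh]
      rfl
    have hd : Glue.desc φ p hφf = β ∘ₗ g := Glue.hom_ext
      (fun y => by rw [Glue.desc_inl, LinearMap.comp_apply, gl, hαβ])
      (fun q => by rw [Glue.desc_inr, LinearMap.comp_apply, gr, hβh])
    have hd' : Glue.desc φ p hφf ∘ₗ e.symm.toLinearMap = β := by
      rw [hd]
      exact LinearMap.ext fun j => congrArg β (e.apply_symm_apply j)
    exact ⟨⟨⟨f, LinearMap.ext hφf⟩, e⟩, Sigma.subtype_ext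
      (Subtype.ext (Prod.ext (LinearMap.ext gl) hd')) (LinearMap.ext gr)⟩

variable {ι : Type} {V : ι → FinMod A}

theorem finsum_card_factorization
    (hrep : ∀ W : FinMod A, ∃! i : ι, Nonempty (W.carrier ≃ₗ[A] (V i).carrier))
    {Z : Type} [AddCommGroup Z] [Module A Z] [Finite Z]
    [Finite Y] [Finite X] [Finite P]
    [Module.Projective A P] {κ : Z →ₗ[A] Y}
    (hκ : Function.Injective κ) (hκφ : LinearMap.range κ = LinearMap.ker φ)
    (hφψ : LinearMap.range φ = LinearMap.ker ψ) (hψp : Function.Surjective (ψ ∘ₗ p))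
    {f₀ : LinearMap.ker (ψ ∘ₗ p) →ₗ[A] Y}
    (hf₀ : φ ∘ₗ f₀ = p ∘ₗ (LinearMap.ker (ψ ∘ₗ p)).subtype) :
    (∑ᶠ J : ι, (Nat.card (Factorization φ (V J).carrier) : ℚ) / autCard A (V J).carrier)
        * Nat.card (P →ₗ[A] Z)
      = Nat.card (LinearMap.ker (ψ ∘ₗ p) →ₗ[A] Z) := by
  have hP : (Nat.card (P →ₗ[A] Z) : ℚ) ≠ 0 := by
    have : Nat.card (P →ₗ[A] Z) ≠ 0 := Nat.card_pos.ne'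
    exact_mod_cast this
  let F := {f : LinearMap.ker (ψ ∘ₗ p) →ₗ[A] Y //
    φ ∘ₗ f = p ∘ₗ (LinearMap.ker (ψ ∘ₗ p)).subtype}
  let W : F → FinMod A := fun f => ⟨Glue f.1 (LinearMap.ker (ψ ∘ₗ p)).subtype⟩
  have := Fintype.ofFinite F
  have key : ∀ J : ι,
      (Nat.card (Factorization φ (V J).carrier) : ℚ) / autCard A (V J).carrier
        * Nat.card (P →ₗ[A] Z)
      = ∑ f : F, (Nat.card ((W f).carrier ≃ₗ[A] (V J).carrier) : ℚ)
          / autCard A (V J).carrier := fun J => by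
    have h1 := card_sigma_factorization_lift (J := (V J).carrier) (p := p) hκ hκφ
    rw [card_sigma_factorization_eq hφψ hψp, Nat.card_sigma
      (β := fun f : F => Glue f.1 (LinearMap.ker (ψ ∘ₗ p)).subtype ≃ₗ[A] (V J).carrier)] at h1
    rw [← Finset.sum_div, div_mul_eq_mul_div]
    congr 1
    exact_mod_cast h1.symm
  rw [finsum_mul', finsum_congr key, finsum_sum_comm _ _ fun f _ =>
    support_card_linearEquiv hrep (W f)]
  · simp_rw [finsum_card_linearEquiv hrep]
    rw [Finset.sum_const, Finset.card_univ, ← Nat.card_eq_fintype_card, card_lifts hκ hκφ hf₀]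
    simp
  · refine (Set.finite_iUnion fun f => support_card_linearEquiv hrep (W f)).subset fun J hJ => ?_
    have h1 := mul_ne_zero hJ hP
    rw [key] at h1
    obtain ⟨f, -, hf⟩ := Finset.exists_ne_zero_of_sum_ne_zero h1
    exact Set.mem_iUnion.2 ⟨f, hf⟩

end Factorization

section ShortExactSequences

variable (A : Type) [Ring A]

/-- Short exact sequences `0 → N → R → M → 0`. -/
abbrev SES (M N R : Type) [AddCommGroup M] [Module A M] [AddCommGroup N] [Module A N]
    [AddCommGroup R] [Module A R] : Type :=
  {ab : (N →ₗ[A] R) × (R →ₗ[A] M) //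
    Function.Injective ab.1 ∧ Function.Surjective ab.2 ∧
      LinearMap.range ab.1 = LinearMap.ker ab.2}

variable {A}
variable {M N R M' N' : Type} [AddCommGroup M] [Module A M] [AddCommGroup N] [Module A N]
  [AddCommGroup R] [Module A R] [AddCommGroup M'] [Module A M'] [AddCommGroup N'] [Module A N']

namespace SES

/-- The injection of a short exact sequence. -/
abbrev i (s : SES A M N R) : N →ₗ[A] R := s.1.1

/-- The surjection of a short exact sequence. -/
abbrev q (s : SES A M N R) : R →ₗ[A] M := s.1.2

theorem inj (s : SES A M N R) : Function.Injective s.i := s.2.1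

theorem surj (s : SES A M N R) : Function.Surjective s.q := s.2.2.1

theorem range_eq_ker (s : SES A M N R) : LinearMap.range s.i = LinearMap.ker s.q := s.2.2.2

@[simp]
theorem q_i (s : SES A M N R) (n : N) : s.q (s.i n) = 0 := by
  rw [← LinearMap.mem_ker, ← s.range_eq_ker]
  exact ⟨n, rfl⟩

theorem exists_i_eq (s : SES A M N R) {r : R} (h : s.q r = 0) : ∃ n, s.i n = r := by
  rw [← LinearMap.mem_ker, ← s.range_eq_ker] at h
  exact h

theorem ext {s t : SES A M N R} (hi : ∀ n, s.i n = t.i n) (hq : ∀ r, s.q r = t.q r) : s = t :=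
  Subtype.ext (Prod.ext (LinearMap.ext hi) (LinearMap.ext hq))

/-- Transport of a short exact sequence along isomorphisms of its ends. -/
def congr (s : SES A M N R) (eM : M ≃ₗ[A] M') (eN : N ≃ₗ[A] N') : SES A M' N' R :=
  ⟨(s.i ∘ₗ eN.symm.toLinearMap, eM.toLinearMap ∘ₗ s.q),
    s.inj.comp eN.symm.injective, eM.surjective.comp s.surj, by
      rw [LinearEquiv.range_comp, LinearEquiv.ker_comp, s.range_eq_ker]⟩

@[simp]
theorem congr_i (s : SES A M N R) (eM : M ≃ₗ[A] M') (eN : N ≃ₗ[A] N') (n : N') :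
    (s.congr eM eN).i n = s.i (eN.symm n) := rfl

@[simp]
theorem congr_q (s : SES A M N R) (eM : M ≃ₗ[A] M') (eN : N ≃ₗ[A] N') (r : R) :
    (s.congr eM eN).q r = eM (s.q r) := rfl

theorem card_eq [Finite R] (s : SES A M N R) : Nat.card R = Nat.card M * Nat.card N := by
  have h := AddSubgroup.card_mul_index s.q.toAddMonoidHom.ker
  rw [AddSubgroup.index_ker, AddMonoidHom.range_eq_top.2 s.surj, AddSubgroup.card_top,
    Nat.card_congr (LinearEquiv.ofInjective s.i s.inj).toEquiv, s.range_eq_ker] at *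
  rw [← h, mul_comm]
  rfl

end SES

theorem exists_linearEquiv_of_surjective {q : R →ₗ[A] M} {q' : R →ₗ[A] M'}
    (hq : Function.Surjective q) (hq' : Function.Surjective q')
    (h : LinearMap.ker q = LinearMap.ker q') : ∃ e : M ≃ₗ[A] M', ∀ r, e (q r) = q' r := by
  refine ⟨(q.quotKerEquivOfSurjective hq).symm ≪≫ₗ Submodule.quotEquivOfEq _ _ h ≪≫ₗ
    q'.quotKerEquivOfSurjective hq', fun r => ?_⟩
  have : (q.quotKerEquivOfSurjective hq).symm (q r) = Submodule.Quotient.mk r := by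
    rw [LinearEquiv.symm_apply_eq]
    rfl
  simp only [LinearEquiv.trans_apply, this]
  rfl

theorem exists_linearEquiv_of_injective {i : N →ₗ[A] R} {i' : N' →ₗ[A] R}
    (hi : Function.Injective i) (hi' : Function.Injective i')
    (h : LinearMap.range i = LinearMap.range i') : ∃ e : N ≃ₗ[A] N', ∀ n, i' (e n) = i n := by
  refine ⟨LinearEquiv.ofInjective i hi ≪≫ₗ LinearEquiv.ofEq _ _ h ≪≫ₗ
    (LinearEquiv.ofInjective i' hi').symm, fun n => ?_⟩
  exact congrArg Subtype.val ((LinearEquiv.ofInjective i' hi').apply_symm_apply _)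

end ShortExactSequences

section Frames

variable {A : Type} [Ring A] {M N K L J : Type}
  [AddCommGroup M] [Module A M] [AddCommGroup N] [Module A N]
  [AddCommGroup K] [Module A K] [AddCommGroup L] [Module A L] [AddCommGroup J] [Module A J]
  {K₁ K₂ L₁ L₂ : Type}
  [AddCommGroup K₁] [Module A K₁] [AddCommGroup K₂] [Module A K₂]
  [AddCommGroup L₁] [Module A L₁] [AddCommGroup L₂] [Module A L₂]
  {K₁' K₂' L₁' L₂' : Type}
  [AddCommGroup K₁'] [Module A K₁'] [AddCommGroup K₂'] [Module A K₂']
  [AddCommGroup L₁'] [Module A L₁'] [AddCommGroup L₂'] [Module A L₂']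

variable (A M N K L K₁ K₂ L₁ L₂) in
/-- The four outer short exact sequences of a `3 × 3` diagram with middle row
`N → J → M` and middle column `L → J → K`. -/
abbrev Frame : Type :=
  SES A K₂ K₁ K × SES A L₂ L₁ L × SES A K₂ L₂ M × SES A K₁ L₁ N

variable (A M N K L J) in
/-- A pair of short exact sequences `N → J → M` and `L → J → K`. -/
abbrev Cross : Type := SES A M N J × SES A K L J

/-- The frame `F` and the cross `c` form a commutative `3 × 3` diagram. -/
def Compatible (F : Frame A M N K L K₁ K₂ L₁ L₂) (c : Cross A M N K L J) : Prop :=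
  (∀ u, c.1.i (F.2.2.2.i u) = c.2.i (F.2.1.i u)) ∧
  (∀ n, c.2.q (c.1.i n) = F.1.i (F.2.2.2.q n)) ∧
  (∀ l, c.1.q (c.2.i l) = F.2.2.1.i (F.2.1.q l)) ∧
  ∀ j, F.2.2.1.q (c.1.q j) = F.1.q (c.2.q j)

/-- Every cross has a compatible frame. -/
theorem exists_compatible [Finite N] [Finite K] [Finite M] (c : Cross A M N K L J) :
    ∃ (U₁ U₂ W₁ W₂ : FinMod A) (F : Frame A M N K L U₁.carrier U₂.carrier W₁.carrier W₂.carrier),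
      Compatible F c := by
  obtain ⟨s, t⟩ := c
  let g : N →ₗ[A] K := t.q ∘ₗ s.i
  let h : L →ₗ[A] M := s.q ∘ₗ t.i
  have hm : ∀ u, (s.i ∘ₗ (LinearMap.ker g).subtype) u ∈ LinearMap.range t.i := fun u => by
    rw [t.range_eq_ker]
    exact u.2
  let i₂ : LinearMap.ker g →ₗ[A] L := (LinearEquiv.ofInjective t.i t.inj).symm.toLinearMap ∘ₗ
    (s.i ∘ₗ (LinearMap.ker g).subtype).codRestrict _ hm
  have hi₂ : ∀ u, t.i (i₂ u) = s.i u := fun u =>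
    congrArg Subtype.val ((LinearEquiv.ofInjective t.i t.inj).apply_symm_apply _)
  let e := s.q.quotKerEquivOfSurjective s.surj
  have hk : LinearMap.ker s.q ≤ LinearMap.ker ((LinearMap.range g).mkQ ∘ₗ t.q) := by
    rw [← s.range_eq_ker]
    rintro _ ⟨n, rfl⟩
    simpa using ⟨n, rfl⟩
  let q₃ : M →ₗ[A] K ⧸ LinearMap.range g := (LinearMap.ker s.q).liftQ _ hk ∘ₗ e.symm.toLinearMap
  have hq₃ : ∀ j, q₃ (s.q j) = (LinearMap.range g).mkQ (t.q j) := fun j => by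
    have : e.symm (s.q j) = (LinearMap.ker s.q).mkQ j := by
      rw [LinearEquiv.symm_apply_eq]
      rfl
    change (LinearMap.ker s.q).liftQ _ hk (e.symm (s.q j)) = _
    rw [this]
    rfl
  have : Finite (K ⧸ LinearMap.range g) := Quotient.finite _
  refine ⟨⟨LinearMap.range g⟩, ⟨K ⧸ LinearMap.range g⟩, ⟨LinearMap.ker g⟩, ⟨LinearMap.range h⟩,
    ⟨⟨((LinearMap.range g).subtype, (LinearMap.range g).mkQ), ?_, ?_, ?_⟩,
     ⟨(i₂, h.rangeRestrict), ?_, ?_, ?_⟩,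
     ⟨((LinearMap.range h).subtype, q₃), ?_, ?_, ?_⟩,
     ⟨((LinearMap.ker g).subtype, g.rangeRestrict), ?_, ?_, ?_⟩⟩, ?_, ?_, ?_, ?_⟩
  · exact Submodule.injective_subtype _
  · exact Submodule.mkQ_surjective _
  · simp
  · intro u v huv
    apply Subtype.ext
    apply s.inj
    rw [← hi₂, ← hi₂]
    exact congrArg _ huv
  · exact LinearMap.surjective_rangeRestrict _
  · ext l
    rw [LinearMap.ker_rangeRestrict]
    constructor
    · rintro ⟨u, rfl⟩
      change s.q (t.i (i₂ u)) = 0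
      rw [hi₂, SES.q_i]
    · intro hl
      obtain ⟨n, hn⟩ := s.exists_i_eq (show s.q (t.i l) = 0 from hl)
      refine ⟨⟨n, ?_⟩, t.inj ?_⟩
      · change t.q (s.i n) = 0
        rw [hn, SES.q_i]
      · exact (hi₂ _).trans hn
  · exact Submodule.injective_subtype _
  · intro x
    obtain ⟨k, rfl⟩ := Submodule.mkQ_surjective _ x
    obtain ⟨j, rfl⟩ := t.surj k
    exact ⟨s.q j, hq₃ j⟩
  · rw [Submodule.range_subtype]
    ext m
    constructor
    · rintro ⟨l, rfl⟩
      change q₃ (s.q (t.i l)) = 0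
      rw [hq₃, SES.q_i, map_zero]
    · intro hm
      obtain ⟨j, rfl⟩ := s.surj m
      have hm' : t.q j ∈ LinearMap.range g := by
        have := (hq₃ j).symm.trans hm
        simpa using this
      obtain ⟨n, hn⟩ := hm'
      obtain ⟨l, hl⟩ := t.exists_i_eq (show t.q (j - s.i n) = 0 by
        rw [map_sub, sub_eq_zero]
        exact hn.symm)
      refine ⟨l, ?_⟩
      change s.q (t.i l) = _
      rw [hl, map_sub, SES.q_i, sub_zero]
  · exact Submodule.injective_subtype _
  · exact LinearMap.surjective_rangeRestrict _
  · rw [LinearMap.ker_rangeRestrict, Submodule.range_subtype]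
  · exact fun u => (hi₂ u).symm
  · exact fun n => rfl
  · exact fun l => rfl
  · exact hq₃

/-- Two frames compatible with the same cross are uniquely isomorphic. -/
theorem card_compatible {F : Frame A M N K L K₁ K₂ L₁ L₂} {c : Cross A M N K L J}
    (hF : Compatible F c) :
    Nat.card {F' : Frame A M N K L K₁' K₂' L₁' L₂' // Compatible F' c}
      = Nat.card (K₁ ≃ₗ[A] K₁') * Nat.card (K₂ ≃ₗ[A] K₂') * Nat.card (L₁ ≃ₗ[A] L₁')
        * Nat.card (L₂ ≃ₗ[A] L₂') := by
  rw [← Nat.card_prod, ← Nat.card_prod, ← Nat.card_prod]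
  symm
  obtain ⟨s₁, s₂, s₃, s₄⟩ := F
  obtain ⟨s, t⟩ := c
  obtain ⟨h1, h2, h3, h4⟩ := hF
  dsimp only at h1 h2 h3 h4
  refine Nat.card_congr (Equiv.ofBijective (fun e =>
    ⟨⟨s₁.congr e.1.1.2 e.1.1.1, s₂.congr e.2 e.1.2, s₃.congr e.1.1.2 e.2,
      s₄.congr e.1.1.1 e.1.2⟩, ?_, ?_, ?_, ?_⟩) ⟨?_, ?_⟩)
  · intro u
    simp [h1]
  · intro n
    simp [h2]
  · intro l
    simp [h3]
  · intro j
    simp [h4]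
  · rintro ⟨⟨⟨e₁, e₂⟩, e₃⟩, e₄⟩ ⟨⟨⟨f₁, f₂⟩, f₃⟩, f₄⟩ h
    have g1 : s₁.congr e₂ e₁ = s₁.congr f₂ f₁ := congrArg (fun z => z.1.1) h
    have g2 : s₂.congr e₄ e₃ = s₂.congr f₄ f₃ := congrArg (fun z => z.1.2.1) h
    have g4 : s₄.congr e₁ e₃ = s₄.congr f₁ f₃ := congrArg (fun z => z.1.2.2.2) h
    have a1 : e₁ = f₁ := LinearEquiv.ext fun x => by
      obtain ⟨n, rfl⟩ := s₄.surj x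
      exact LinearMap.congr_fun (congrArg SES.q g4) n
    have a2 : e₂ = f₂ := LinearEquiv.ext fun x => by
      obtain ⟨n, rfl⟩ := s₁.surj x
      exact LinearMap.congr_fun (congrArg SES.q g1) n
    have a3 : e₃.symm = f₃.symm := LinearEquiv.ext fun x =>
      s₄.inj (LinearMap.congr_fun (congrArg SES.i g4) x)
    have a4 : e₄ = f₄ := LinearEquiv.ext fun x => by
      obtain ⟨n, rfl⟩ := s₂.surj x
      exact LinearMap.congr_fun (congrArg SES.q g2) n
    rw [a1, a2, a4, ← e₃.symm_symm, a3, f₃.symm_symm]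
  · rintro ⟨⟨r₁, r₂, r₃, r₄⟩, k1, k2, k3, k4⟩
    dsimp only at k1 k2 k3 k4
    obtain ⟨e₁, he₁⟩ := exists_linearEquiv_of_surjective s₄.surj r₄.surj (by
      ext n
      rw [LinearMap.mem_ker, LinearMap.mem_ker, ← map_eq_zero_iff _ s₁.inj,
        ← map_eq_zero_iff _ r₁.inj, ← h2, ← k2])
    obtain ⟨e₄, he₄⟩ := exists_linearEquiv_of_surjective s₂.surj r₂.surj (by
      ext n
      rw [LinearMap.mem_ker, LinearMap.mem_ker, ← map_eq_zero_iff _ s₃.inj,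
        ← map_eq_zero_iff _ r₃.inj, ← h3, ← k3])
    have hi₁ : ∀ x, s₁.i x = r₁.i (e₁ x) := fun x => by
      obtain ⟨n, rfl⟩ := s₄.surj x
      rw [← h2, k2, he₁]
    have hi₃ : ∀ x, s₃.i x = r₃.i (e₄ x) := fun x => by
      obtain ⟨n, rfl⟩ := s₂.surj x
      rw [← h3, k3, he₄]
    obtain ⟨e₃, he₃⟩ := exists_linearEquiv_of_injective s₄.inj r₄.inj (by
      ext n
      rw [s₄.range_eq_ker, r₄.range_eq_ker, LinearMap.mem_ker, LinearMap.mem_ker, ← he₁,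
        map_eq_zero_iff _ e₁.injective])
    obtain ⟨e₂, he₂⟩ := exists_linearEquiv_of_surjective s₁.surj r₁.surj (by
      rw [← s₁.range_eq_ker, ← r₁.range_eq_ker]
      ext k
      constructor
      · rintro ⟨x, rfl⟩
        exact ⟨e₁ x, (hi₁ x).symm⟩
      · rintro ⟨x, rfl⟩
        exact ⟨e₁.symm x, by rw [hi₁, e₁.apply_symm_apply]⟩)
    refine ⟨⟨⟨⟨e₁, e₂⟩, e₃⟩, e₄⟩, Subtype.ext (Prod.ext (SES.ext ?_ ?_)
      (Prod.ext (SES.ext ?_ ?_) (Prod.ext (SES.ext ?_ ?_) (SES.ext ?_ ?_))))⟩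
    · intro x
      simp [hi₁]
    · intro k
      simp [he₂]
    · intro u
      apply t.inj
      simp [← h1, ← k1, ← he₃]
    · intro l
      simp [he₄]
    · intro x
      simp [hi₃]
    · intro m
      obtain ⟨j, rfl⟩ := s.surj m
      simp [h4, k4, he₂]
    · intro u
      simp [← he₃]
    · intro n
      simp [he₁]

end Frames

section FactorizationCount

variable {A : Type} [Ring A] [Finite A] [HasExt.{w} (ModuleCat A)] {Z Y X Q : Type}
  [AddCommGroup Z] [Module A Z] [Finite Z] [AddCommGroup Y] [Module A Y] [Finite Y]
  [AddCommGroup X] [Module A X] [Finite X] [AddCommGroup Q] [Module A Q] [Finite Q]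

/-- The mass of the groupoid of factorizations of the middle map of an exact sequence
`0 → Z → Y → X → Q → 0`. -/
theorem finsum_card_factorization_eq_div
    (hhered : ∀ X Y : FinMod A,
      Subsingleton (Abelian.Ext (ModuleCat.of A X.carrier) (ModuleCat.of A Y.carrier) 2))
    {ι : Type} {V : ι → FinMod A}
    (hrep : ∀ W : FinMod A, ∃! i : ι, Nonempty (W.carrier ≃ₗ[A] (V i).carrier))
    {κ : Z →ₗ[A] Y} {φ : Y →ₗ[A] X} {ψ : X →ₗ[A] Q} (hκ : Function.Injective κ)
    (hκφ : LinearMap.range κ = LinearMap.ker φ) (hφψ : LinearMap.range φ = LinearMap.ker ψ)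
    (hψ : Function.Surjective ψ) :
    ∑ᶠ J : ι, (Nat.card (Factorization φ (V J).carrier) : ℚ) / autCard A (V J).carrier
      = (Nat.card (Abelian.Ext (ModuleCat.of A Q) (ModuleCat.of A Z) 1) : ℚ)
        / Nat.card (Q →ₗ[A] Z) := by
  have := Fintype.ofFinite Q
  obtain ⟨p, hp⟩ := Module.projective_lifting_property ψ
    (Fintype.linearCombination A (id : Q → Q)) hψ
  have hs : Function.Surjective (ψ ∘ₗ p) := by
    classical
    rw [hp]
    exact fun x => ⟨Pi.single x 1, by simp [Fintype.linearCombination_apply_single]⟩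
  have hm : ∀ u, (p ∘ₗ (LinearMap.ker (ψ ∘ₗ p)).subtype) u ∈ LinearMap.range φ := fun u => by
    rw [hφψ]
    exact u.2
  obtain ⟨f₀, hf₀⟩ := exists_lift_of_ext_two hs (LinearMap.surjective_rangeRestrict φ)
    (hhered ⟨Q⟩ ⟨LinearMap.ker φ.rangeRestrict⟩) (LinearMap.codRestrict _ _ hm)
  have h1 := finsum_card_factorization (p := p) (f₀ := f₀) hrep hκ hκφ hφψ hs
    (LinearMap.ext fun u => congrArg Subtype.val (LinearMap.congr_fun hf₀ u))
  have h2 := card_ext_one_mul_card_hom (Y := Z) hs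
  have hP : (Nat.card ((Q → A) →ₗ[A] Z) : ℚ) ≠ 0 :=
    Nat.cast_ne_zero.2 Nat.card_pos.ne'
  have hQ : (Nat.card (Q →ₗ[A] Z) : ℚ) ≠ 0 :=
    Nat.cast_ne_zero.2 Nat.card_pos.ne'
  rw [eq_div_iff hQ]
  apply mul_right_cancel₀ hP
  rw [mul_right_comm, h1, mul_comm]
  exact_mod_cast h2.symm

end FactorizationCount

section Completions

variable {A : Type} [Ring A] {M N K L : Type}
  [AddCommGroup M] [Module A M] [AddCommGroup N] [Module A N]
  [AddCommGroup K] [Module A K] [AddCommGroup L] [Module A L]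
  {K₁ K₂ L₁ L₂ : Type}
  [AddCommGroup K₁] [Module A K₁] [AddCommGroup K₂] [Module A K₂]
  [AddCommGroup L₁] [Module A L₁] [AddCommGroup L₂] [Module A L₂]

namespace Frame

variable (F : Frame A M N K L K₁ K₂ L₁ L₂)

/-- The fibre product of `M` and `K` over `K₂`. -/
abbrev Target : Submodule A (M × K) :=
  LinearMap.ker (F.2.2.1.q ∘ₗ LinearMap.fst A M K - F.1.q ∘ₗ LinearMap.snd A M K)

theorem mem_target {x : M × K} : x ∈ Target F ↔ F.2.2.1.q x.1 = F.1.q x.2 := by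
  rw [LinearMap.mem_ker]
  simp [sub_eq_zero]

/-- The amalgamated sum of `N` and `L` over `L₁`. -/
abbrev Source : Type := Glue F.2.2.2.i F.2.1.i

/-- The map from the amalgamated sum to the fibre product determined by a frame. -/
def map : Source F →ₗ[A] Target F :=
  Glue.desc
    ((LinearMap.inr A M K ∘ₗ F.1.i ∘ₗ F.2.2.2.q).codRestrict _ fun n =>
      (mem_target F).2 (by simp))
    ((LinearMap.inl A M K ∘ₗ F.2.2.1.i ∘ₗ F.2.1.q).codRestrict _ fun n =>
      (mem_target F).2 (by simp))
    (fun u => Subtype.ext (by simp))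

theorem map_apply (n : N) (l : L) :
    (map F (Glue.inl _ _ n + Glue.inr _ _ l)).1 = (F.2.2.1.i (F.2.1.q l), F.1.i (F.2.2.2.q n)) := by
  simp [map]

/-- The map from the fibre product to the common quotient. -/
def toQuotient : Target F →ₗ[A] K₂ := F.1.q ∘ₗ LinearMap.snd A M K ∘ₗ (Target F).subtype

theorem toQuotient_surjective : Function.Surjective (toQuotient F) := fun x => by
  obtain ⟨k, rfl⟩ := F.1.surj x
  obtain ⟨m, hm⟩ := F.2.2.1.surj (F.1.q k)
  exact ⟨⟨(m, k), (mem_target F).2 hm⟩, rfl⟩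

theorem range_inl_comp_i :
    LinearMap.range (Glue.inl F.2.2.2.i F.2.1.i ∘ₗ F.2.2.2.i) = LinearMap.ker (map F) := by
  ext x
  constructor
  · rintro ⟨u, rfl⟩
    refine LinearMap.mem_ker.2 (Subtype.ext ?_)
    have := map_apply F (F.2.2.2.i u) 0
    rw [map_zero, add_zero, SES.q_i, map_zero, map_zero, map_zero] at this
    exact this
  · intro hx
    obtain ⟨n, l, rfl⟩ := Glue.exists_eq x
    have h := map_apply F n l
    rw [LinearMap.mem_ker.1 hx] at h
    have hl : F.2.1.q l = 0 := F.2.2.1.inj (by simpa using (congrArg Prod.fst h).symm)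
    have hn : F.2.2.2.q n = 0 := F.1.inj (by simpa using (congrArg Prod.snd h).symm)
    obtain ⟨u, rfl⟩ := F.2.2.2.exists_i_eq hn
    obtain ⟨v, rfl⟩ := F.2.1.exists_i_eq hl
    refine ⟨u + v, ?_⟩
    rw [← Glue.condition, ← map_add, ← map_add]
    rfl

theorem range_map : LinearMap.range (map F) = LinearMap.ker (toQuotient F) := by
  ext x
  constructor
  · rintro ⟨y, rfl⟩
    obtain ⟨n, l, rfl⟩ := Glue.exists_eq y
    exact (congrArg (fun z => F.1.q z.2) (map_apply F n l)).trans (SES.q_i _ _)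
  · intro hx
    have hk : F.1.q x.1.2 = 0 := hx
    have hm : F.2.2.1.q x.1.1 = 0 := ((mem_target F).1 x.2).trans hk
    obtain ⟨u, hu⟩ := F.1.exists_i_eq hk
    obtain ⟨v, hv⟩ := F.2.2.1.exists_i_eq hm
    obtain ⟨n, rfl⟩ := F.2.2.2.surj u
    obtain ⟨l, rfl⟩ := F.2.1.surj v
    exact ⟨_, Subtype.ext ((map_apply F n l).trans (Prod.ext hv hu))⟩

/-- Crosses compatible with a frame are factorizations of the map determined by the frame. -/
theorem card_factorization (J : Type) [AddCommGroup J] [Module A J] :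
    Nat.card {c : Cross A M N K L J // Compatible F c} = Nat.card (Factorization (map F) J) := by
  refine Nat.card_congr (Equiv.ofBijective (fun c =>
    ⟨(Glue.desc c.1.1.i c.1.2.i c.2.1,
      (c.1.1.q.prod c.1.2.q).codRestrict (Target F) fun j => (mem_target F).2 (c.2.2.2.2 j)),
      ?_, ?_, ?_, ?_⟩) ⟨?_, ?_⟩)
  · obtain ⟨⟨s, t⟩, h1, h2, h3, h4⟩ := c
    dsimp only at h1 h2 h3 h4 ⊢
    rw [← LinearMap.ker_eq_bot, LinearMap.ker_eq_bot']
    intro x hx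
    obtain ⟨n, l, rfl⟩ := Glue.exists_eq x
    rw [map_add, Glue.desc_inl, Glue.desc_inr] at hx
    have hl : F.2.1.q l = 0 := F.2.2.1.inj (by
      rw [← h3, map_zero, ← map_zero s.q, ← hx, map_add, SES.q_i, zero_add])
    obtain ⟨u, rfl⟩ := F.2.1.exists_i_eq hl
    rw [← h1, ← map_add] at hx
    rw [← Glue.condition, ← map_add, s.inj (hx.trans (map_zero _).symm), map_zero]
  · obtain ⟨⟨s, t⟩, h1, h2, h3, h4⟩ := c
    dsimp only at h1 h2 h3 h4 ⊢
    rintro ⟨⟨m, k⟩, hx⟩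
    have hmk : F.2.2.1.q m = F.1.q k := (mem_target F).1 hx
    obtain ⟨j, rfl⟩ := s.surj m
    obtain ⟨u, hu⟩ := F.1.exists_i_eq (show F.1.q (k - t.q j) = 0 by
      rw [map_sub, ← h4, hmk, sub_self])
    obtain ⟨n, rfl⟩ := F.2.2.2.surj u
    refine ⟨j + s.i n, Subtype.ext (Prod.ext ?_ ?_)⟩
    · change s.q (j + s.i n) = s.q j
      rw [map_add, SES.q_i, add_zero]
    · change t.q (j + s.i n) = k
      rw [map_add, h2, hu, add_sub_cancel]
  · obtain ⟨⟨s, t⟩, h1, h2, h3, h4⟩ := c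
    dsimp only at h1 h2 h3 h4 ⊢
    intro y
    obtain ⟨n, l, rfl⟩ := Glue.exists_eq y
    rw [map_add (Glue.desc _ _ _), Glue.desc_inl, Glue.desc_inr]
    refine Subtype.ext ((Prod.ext ?_ ?_).trans (map_apply F n l).symm)
    · change s.q (s.i n + t.i l) = _
      rw [map_add, SES.q_i, zero_add, h3]
    · change t.q (s.i n + t.i l) = _
      rw [map_add, SES.q_i, add_zero, h2]
  · obtain ⟨⟨s, t⟩, h1, h2, h3, h4⟩ := c
    dsimp only at h1 h2 h3 h4 ⊢
    intro j hj
    have hj' := congrArg Subtype.val (LinearMap.mem_ker.1 hj)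
    obtain ⟨n, rfl⟩ := s.exists_i_eq (show s.q j = 0 from congrArg Prod.fst hj')
    exact ⟨Glue.inl _ _ n, Glue.desc_inl _ _ _ n⟩
  · rintro ⟨⟨s, t⟩, hst⟩ ⟨⟨s', t'⟩, hst'⟩ h
    have hα := LinearMap.congr_fun (congrArg (fun c => c.1.1) h)
    have hβ := LinearMap.congr_fun (congrArg (fun c => c.1.2) h)
    refine Subtype.ext (Prod.ext (SES.ext (fun n => ?_) fun j => ?_)
      (SES.ext (fun l => ?_) fun j => ?_))
    · exact (Glue.desc_inl _ _ hst.1 n).symm.trans ((hα _).trans (Glue.desc_inl _ _ hst'.1 n))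
    · exact congrArg (fun z => z.1.1) (hβ j)
    · exact (Glue.desc_inr _ _ hst.1 l).symm.trans ((hα _).trans (Glue.desc_inr _ _ hst'.1 l))
    · exact congrArg (fun z => z.1.2) (hβ j)
  · rintro ⟨⟨α, β⟩, hα, hβ, hαβ, hk⟩
    dsimp only at hα hβ hαβ hk
    have hr : ∀ n l, (β (α (Glue.inl _ _ n + Glue.inr _ _ l))).1
        = (F.2.2.1.i (F.2.1.q l), F.1.i (F.2.2.2.q n)) := fun n l => by
      rw [hαβ, map_apply]
    have hl1 : ∀ n, (β (α (Glue.inl _ _ n))).1 = (0, F.1.i (F.2.2.2.q n)) := fun n => by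
      simpa using hr n 0
    have hr1 : ∀ l, (β (α (Glue.inr _ _ l))).1 = (F.2.2.1.i (F.2.1.q l), 0) := fun l => by
      simpa using hr 0 l
    have hb : ∀ j, F.2.2.1.q (β j).1.1 = F.1.q (β j).1.2 := fun j => (mem_target F).1 (β j).2
    have hker : ∀ x, β (α x) = 0 → ∃ u, Glue.inl _ _ (F.2.2.2.i u) = x := fun x hx => by
      have : x ∈ LinearMap.ker (map F) := (hαβ x).symm.trans hx
      rw [← range_inl_comp_i] at this
      exact this
    have hdec : ∀ j n l, (β j).1 = (F.2.2.1.i (F.2.1.q l), F.1.i (F.2.2.2.q n)) →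
        ∃ u, j = α (Glue.inl _ _ (n + F.2.2.2.i u) + Glue.inr _ _ l) ∧
          j = α (Glue.inl _ _ n + Glue.inr _ _ (l + F.2.1.i u)) := fun j n l h => by
      have h0 : β (j - α (Glue.inl _ _ n + Glue.inr _ _ l)) = 0 := by
        rw [map_sub, sub_eq_zero]
        exact Subtype.ext (h.trans (hr n l).symm)
      obtain ⟨x, hx⟩ := hk h0
      obtain ⟨u, rfl⟩ := hker x (by rw [hx, h0])
      have hj := eq_add_of_sub_eq hx.symm
      rw [← map_add] at hj
      refine ⟨u, ?_, ?_⟩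
      · rw [hj, map_add (Glue.inl _ _) n]
        congr 1
        abel
      · rw [hj, map_add (Glue.inr _ _) l, Glue.condition]
        congr 1
        abel
    refine ⟨⟨⟨⟨(α ∘ₗ Glue.inl _ _, LinearMap.fst A M K ∘ₗ (Target F).subtype ∘ₗ β), ?_, ?_, ?_⟩,
      ⟨(α ∘ₗ Glue.inr _ _, LinearMap.snd A M K ∘ₗ (Target F).subtype ∘ₗ β), ?_, ?_, ?_⟩⟩,
      ?_, ?_, ?_, hb⟩, ?_⟩
    · exact hα.comp (Glue.inl_injective F.2.1.inj)
    · intro m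
      obtain ⟨k, hk'⟩ := F.1.surj (F.2.2.1.q m)
      obtain ⟨j, hj⟩ := hβ ⟨(m, k), (mem_target F).2 hk'.symm⟩
      exact ⟨j, congrArg (fun z => z.1.1) hj⟩
    · ext j
      constructor
      · rintro ⟨n, rfl⟩
        exact congrArg Prod.fst (hl1 n)
      · intro hj
        have hj1 : (β j).1.1 = 0 := hj
        obtain ⟨v, hv⟩ := F.1.exists_i_eq ((hb j).symm.trans (by rw [hj1, map_zero]))
        obtain ⟨n, rfl⟩ := F.2.2.2.surj v
        obtain ⟨u, hu, -⟩ := hdec j n 0 (Prod.ext (by simpa using hj1) hv.symm)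
        exact ⟨n + F.2.2.2.i u, by simpa using hu.symm⟩
    · refine hα.comp ?_
      rw [← LinearMap.ker_eq_bot, LinearMap.ker_eq_bot']
      intro l hl
      obtain ⟨u, hu, rfl⟩ := Glue.inl_add_inr_eq_zero.1
        (show Glue.inl F.2.2.2.i F.2.1.i 0 + Glue.inr _ _ l = 0 by simpa using hl)
      rw [F.2.2.2.inj (hu.trans (map_zero _).symm), map_zero, neg_zero]
    · intro k
      obtain ⟨m, hm⟩ := F.2.2.1.surj (F.1.q k)
      obtain ⟨j, hj⟩ := hβ ⟨(m, k), (mem_target F).2 hm⟩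
      exact ⟨j, congrArg (fun z => z.1.2) hj⟩
    · ext j
      constructor
      · rintro ⟨l, rfl⟩
        exact congrArg Prod.snd (hr1 l)
      · intro hj
        have hj1 : (β j).1.2 = 0 := hj
        obtain ⟨v, hv⟩ := F.2.2.1.exists_i_eq ((hb j).trans (by rw [hj1, map_zero]))
        obtain ⟨l, rfl⟩ := F.2.1.surj v
        obtain ⟨u, -, hu⟩ := hdec j 0 l (Prod.ext hv.symm (by simpa using hj1))
        exact ⟨l + F.2.1.i u, by simpa using hu.symm⟩
    · exact fun u => congrArg α (Glue.condition u)
    · exact fun n => congrArg Prod.snd (hl1 n)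
    · exact fun l => congrArg Prod.fst (hr1 l)
    · have hc : ∀ u, (α ∘ₗ Glue.inl _ _) (F.2.2.2.i u) = (α ∘ₗ Glue.inr _ _) (F.2.1.i u) :=
        fun u => congrArg α (Glue.condition u)
      exact Subtype.ext (Prod.ext
        (Glue.hom_ext (fun n => Glue.desc_inl _ _ hc n) fun l => Glue.desc_inr _ _ hc l)
        (LinearMap.ext fun j => rfl))

variable [HasExt.{w} (ModuleCat A)]

theorem finsum_card_compatible [Finite A] [Finite M] [Finite N] [Finite K] [Finite L]
    [Finite L₁] [Finite K₂]
    (hhered : ∀ X Y : FinMod A,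
      Subsingleton (Abelian.Ext (ModuleCat.of A X.carrier) (ModuleCat.of A Y.carrier) 2))
    {ι : Type} {V : ι → FinMod A}
    (hrep : ∀ W : FinMod A, ∃! i : ι, Nonempty (W.carrier ≃ₗ[A] (V i).carrier)) :
    ∑ᶠ J : ι, (Nat.card {c : Cross A M N K L (V J).carrier // Compatible F c} : ℚ)
        / autCard A (V J).carrier
      = (Nat.card (Abelian.Ext (ModuleCat.of A K₂) (ModuleCat.of A L₁) 1) : ℚ)
        / Nat.card (K₂ →ₗ[A] L₁) := by
  simp_rw [card_factorization]
  exact finsum_card_factorization_eq_div hhered hrep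
    (κ := Glue.inl F.2.2.2.i F.2.1.i ∘ₗ F.2.2.2.i)
    ((Glue.inl_injective F.2.1.inj).comp F.2.2.2.inj)
    (range_inl_comp_i F) (range_map F) (toQuotient_surjective F)

end Frame

end Completions

section Finiteness

variable {A : Type} [Ring A] [Finite A] {ι : Type} {V : ι → FinMod A}

/-- There are finitely many isomorphism classes of modules of bounded cardinality. -/
theorem finite_setOf_card_le
    (hrep : ∀ W : FinMod A, ∃! i : ι, Nonempty (W.carrier ≃ₗ[A] (V i).carrier))
    (n : ℕ) : {i : ι | Nat.card (V i).carrier ≤ n}.Finite := by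
  have h : {i : ι | Nat.card (V i).carrier ≤ n}
      = ⋃ m : Fin (n + 1), {i : ι | Nat.card (V i).carrier = m} := by
    ext i
    simp only [Set.mem_ofPred_eq, Set.mem_iUnion]
    exact ⟨fun h => ⟨⟨_, Nat.lt_succ_of_le h⟩, rfl⟩, fun ⟨m, hm⟩ => hm ▸ Nat.le_of_lt_succ m.2⟩
  rw [h]
  refine Set.finite_iUnion fun m => ?_
  let e : ∀ i : {i : ι | Nat.card (V i).carrier = m}, (V i).carrier ≃ Fin m :=
    fun i => Finite.equivFinOfCardEq i.2
  let tables : {i : ι | Nat.card (V i).carrier = m} →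
      (Fin m → Fin m → Fin m) × (A → Fin m → Fin m) := fun i =>
    (fun x y => e i ((e i).symm x + (e i).symm y), fun a x => e i (a • (e i).symm x))
  have ht : Function.Injective tables := fun i j hij => by
    obtain ⟨h1, h2⟩ := Prod.ext_iff.1 hij
    let f : (V i).carrier ≃ₗ[A] (V j).carrier :=
      { (e i).trans (e j).symm with
        map_add' := fun x y => by
          have := congrFun₂ h1 (e i x) (e i y)
          simpa [tables, Equiv.symm_apply_eq] using this
        map_smul' := fun a x => by
          have := congrFun₂ h2 a (e i x)
          simpa [tables, Equiv.symm_apply_eq] using this }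
    exact Subtype.ext ((hrep (V i)).unique ⟨LinearEquiv.refl A _⟩ ⟨f⟩)
  have := Finite.of_injective tables ht
  exact Set.toFinite _

end Finiteness

section GreenFormula

theorem sum_card_subtype_comm {α β : Type} [Fintype α] [Fintype β] (R : α → β → Prop) :
    ∑ a, Nat.card {b // R a b} = ∑ b, Nat.card {a // R a b} := by
  rw [← Nat.card_sigma, ← Nat.card_sigma]
  exact Nat.card_congr
    { toFun := fun x => ⟨x.2.1, x.1, x.2.2⟩
      invFun := fun x => ⟨x.2.1, x.1, x.2.2⟩
      left_inv := fun _ => rfl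
      right_inv := fun _ => rfl }

theorem nonempty_SES_of_hallP_ne_zero {A M N R : Type} [Ring A] [AddCommGroup M] [Module A M]
    [AddCommGroup N] [Module A N] [AddCommGroup R] [Module A R]
    (h : (hallP A M N R : ℚ) ≠ 0) : Nonempty (SES A M N R) :=
  (Nat.card_ne_zero.1 (Nat.cast_ne_zero.1 h)).1

theorem sum_product_mul {ι : Type} {T : Finset ι} (f₁ f₂ f₃ f₄ : ι → ℚ) :
    ∑ x ∈ T ×ˢ T ×ˢ T ×ˢ T, f₁ x.1 * f₂ x.2.1 * f₃ x.2.2.1 * f₄ x.2.2.2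
      = (∑ i ∈ T, f₁ i) * (∑ i ∈ T, f₂ i) * (∑ i ∈ T, f₃ i) * ∑ i ∈ T, f₄ i := by
  simp only [Finset.sum_product, ← Finset.mul_sum, ← Finset.sum_mul]

variable {A : Type} [Ring A] {M N K L : Type}
  [AddCommGroup M] [Module A M] [Finite M] [AddCommGroup N] [Module A N] [Finite N]
  [AddCommGroup K] [Module A K] [Finite K] [AddCommGroup L] [Module A L] [Finite L]

variable {ι : Type} {V : ι → FinMod A}

theorem sum_card_linearEquiv
    (hrep : ∀ W : FinMod A, ∃! i : ι, Nonempty (W.carrier ≃ₗ[A] (V i).carrier))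
    (W : FinMod A) {T : Finset ι}
    (hT : ∀ i, Nat.card (V i).carrier = Nat.card W.carrier → i ∈ T) :
    ∑ i ∈ T, (Nat.card (W.carrier ≃ₗ[A] (V i).carrier) : ℚ) / autCard A (V i).carrier = 1 := by
  rw [← finsum_card_linearEquiv hrep W, finsum_eq_sum_of_support_subset]
  intro i hi
  obtain ⟨⟨e⟩, -⟩ := Nat.card_ne_zero.1 (Nat.cast_ne_zero.1 (div_ne_zero_iff.1 hi).1)
  exact hT i (Nat.card_congr e.symm.toEquiv)

/-- The groupoid of frames compatible with a given cross has mass one. -/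
theorem sum_card_compatible
    (hrep : ∀ W : FinMod A, ∃! i : ι, Nonempty (W.carrier ≃ₗ[A] (V i).carrier))
    {J : Type} [AddCommGroup J] [Module A J]
    (c : Cross A M N K L J) {T : Finset ι}
    (hT : ∀ i, Nat.card (V i).carrier ≤ Nat.card M + Nat.card K + Nat.card L → i ∈ T) :
    ∑ x ∈ T ×ˢ T ×ˢ T ×ˢ T,
      (Nat.card {F : Frame A M N K L (V x.1).carrier (V x.2.1).carrier (V x.2.2.1).carrier
          (V x.2.2.2).carrier // Compatible F c} : ℚ)
        / ((autCard A (V x.1).carrier : ℚ) * (autCard A (V x.2.1).carrier : ℚ)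
            * (autCard A (V x.2.2.1).carrier : ℚ) * (autCard A (V x.2.2.2).carrier : ℚ)) = 1 := by
  obtain ⟨U₁, U₂, W₁, W₂, F, hF⟩ := exists_compatible c
  have h₁ := Nat.card_le_card_of_injective _ F.1.inj
  have h₂ := Nat.card_le_card_of_surjective _ F.1.surj
  have h₃ := Nat.card_le_card_of_injective _ F.2.1.inj
  have h₄ := Nat.card_le_card_of_injective _ F.2.2.1.inj
  have s₁ := sum_card_linearEquiv hrep U₁ (T := T) fun i hi => hT i (by omega)
  have s₂ := sum_card_linearEquiv hrep U₂ (T := T) fun i hi => hT i (by omega)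
  have s₃ := sum_card_linearEquiv hrep W₁ (T := T) fun i hi => hT i (by omega)
  have s₄ := sum_card_linearEquiv hrep W₂ (T := T) fun i hi => hT i (by omega)
  simp only [card_compatible hF, Nat.cast_mul, mul_div_mul_comm]
  let f : FinMod A → ι → ℚ := fun W i =>
    (Nat.card (W.carrier ≃ₗ[A] (V i).carrier) : ℚ) / autCard A (V i).carrier
  refine (sum_product_mul (f U₁) (f U₂) (f W₁) (f W₂)).trans ?_
  rw [s₁, s₂, s₃, s₄, mul_one, mul_one, mul_one]

/-- Counting the commutative `3 × 3` diagrams with given corners in two ways. -/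
theorem sum_card_cross [HasExt.{w} (ModuleCat A)] [Finite A]
    (hhered : ∀ X Y : FinMod A,
      Subsingleton (Abelian.Ext (ModuleCat.of A X.carrier) (ModuleCat.of A Y.carrier) 2))
    (hrep : ∀ W : FinMod A, ∃! i : ι, Nonempty (W.carrier ≃ₗ[A] (V i).carrier)) {T : Finset ι}
    (hT : ∀ i, Nat.card (V i).carrier ≤ Nat.card M + Nat.card K + Nat.card L → i ∈ T)
    (hT' : ∀ i, Nat.card (V i).carrier = Nat.card M * Nat.card N → i ∈ T) :
    ∑ J ∈ T, (Nat.card (Cross A M N K L (V J).carrier) : ℚ) / autCard A (V J).carrier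
      = ∑ x ∈ T ×ˢ T ×ˢ T ×ˢ T,
        (Nat.card (Abelian.Ext (ModuleCat.of A (V x.2.1).carrier)
            (ModuleCat.of A (V x.2.2.1).carrier) 1) : ℚ)
          / Nat.card ((V x.2.1).carrier →ₗ[A] (V x.2.2.1).carrier)
        * Nat.card (Frame A M N K L (V x.1).carrier (V x.2.1).carrier (V x.2.2.1).carrier
          (V x.2.2.2).carrier)
        / ((autCard A (V x.1).carrier : ℚ) * (autCard A (V x.2.1).carrier : ℚ)
            * (autCard A (V x.2.2.1).carrier : ℚ) * (autCard A (V x.2.2.2).carrier : ℚ)) := by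
  let _ : ∀ J, Fintype (Cross A M N K L (V J).carrier) := fun J => Fintype.ofFinite _
  let _ : ∀ x : ι × ι × ι × ι, Fintype (Frame A M N K L (V x.1).carrier (V x.2.1).carrier
    (V x.2.2.1).carrier (V x.2.2.2).carrier) := fun x => Fintype.ofFinite _
  have hJ : ∀ J, (Nat.card (Cross A M N K L (V J).carrier) : ℚ) = ∑ x ∈ T ×ˢ T ×ˢ T ×ˢ T,
      (∑ F : Frame A M N K L (V x.1).carrier (V x.2.1).carrier (V x.2.2.1).carrier
          (V x.2.2.2).carrier, (Nat.card {c : Cross A M N K L (V J).carrier // Compatible F c} : ℚ))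
        / ((autCard A (V x.1).carrier : ℚ) * (autCard A (V x.2.1).carrier : ℚ)
            * (autCard A (V x.2.2.1).carrier : ℚ) * (autCard A (V x.2.2.2).carrier : ℚ)) := by
    intro J
    simp only [← Nat.cast_sum, sum_card_subtype_comm (fun F c => Compatible F c)]
    simp only [Nat.cast_sum, Finset.sum_div]
    rw [Finset.sum_comm, Finset.sum_congr rfl fun c _ => sum_card_compatible hrep c hT]
    simp
  have hx : ∀ (x : ι × ι × ι × ι) (F : Frame A M N K L (V x.1).carrier (V x.2.1).carrier
      (V x.2.2.1).carrier (V x.2.2.2).carrier),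
      ∑ J ∈ T, (Nat.card {c : Cross A M N K L (V J).carrier // Compatible F c} : ℚ)
        / autCard A (V J).carrier
      = (Nat.card (Abelian.Ext (ModuleCat.of A (V x.2.1).carrier)
            (ModuleCat.of A (V x.2.2.1).carrier) 1) : ℚ)
          / Nat.card ((V x.2.1).carrier →ₗ[A] (V x.2.2.1).carrier) := by
    intro x F
    rw [← F.finsum_card_compatible hhered hrep, finsum_eq_sum_of_support_subset]
    intro J hJ
    obtain ⟨⟨c, -⟩, -⟩ := Nat.card_ne_zero.1 (Nat.cast_ne_zero.1 (div_ne_zero_iff.1 hJ).1)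
    exact hT' J c.1.card_eq
  simp only [hJ, Finset.sum_div]
  rw [Finset.sum_comm]
  refine Finset.sum_congr rfl fun x _ => ?_
  rw [Finset.sum_comm]
  simp only [div_right_comm _ _ (autCard A (V _).carrier : ℚ), ← Finset.sum_div, hx]
  simp [mul_comm, div_mul_eq_mul_div]

end GreenFormula

/-- **Green's formula.**  Let `A` be a finite ring which is hereditary in the sense that
`Ext²_A(X,Y) = 0` for all finite `A`-modules `X, Y`.  Then for all finite `A`-modules
`M, N, K, L`, and any complete irredundant family of representatives `V : ι → FinMod A` of
the isomorphism classes of finite `A`-modules,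
`Σ_{[J]} (1/a_J)·P^J_{M,N}·P^J_{K,L}` equals
`Σ_{[K₁],[K₂],[L₁],[L₂]} (|Ext¹(K₂,L₁)|/|Hom(K₂,L₁)|)·P^K_{K₂,K₁}·P^L_{L₂,L₁}·P^M_{K₂,L₂}·
P^N_{K₁,L₁}/(a_{K₁}a_{K₂}a_{L₁}a_{L₂})`, both sums having finite support. -/
theorem green_formula
    (A : Type) [Ring A] [Finite A] [HasExt.{w} (ModuleCat A)]
    (hhered : ∀ X Y : FinMod A,
      Subsingleton (Abelian.Ext (ModuleCat.of A X.carrier) (ModuleCat.of A Y.carrier) 2))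
    (M N K L : Type)
    [AddCommGroup M] [Module A M] [Finite M]
    [AddCommGroup N] [Module A N] [Finite N]
    [AddCommGroup K] [Module A K] [Finite K]
    [AddCommGroup L] [Module A L] [Finite L]
    (ι : Type) (V : ι → FinMod A)
    (hrep : ∀ W : FinMod A, ∃! i : ι, Nonempty (W.carrier ≃ₗ[A] (V i).carrier)) :
    (Function.support fun J : ι =>
      (1 / (autCard A (V J).carrier : ℚ)) * (hallP A M N (V J).carrier : ℚ)
        * (hallP A K L (V J).carrier : ℚ)).Finite ∧
    (Function.support fun x : ι × ι × ι × ι =>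
      ((Nat.card (Abelian.Ext (ModuleCat.of A (V x.2.1).carrier)
            (ModuleCat.of A (V x.2.2.1).carrier) 1) : ℚ)
          / (Nat.card ((V x.2.1).carrier →ₗ[A] (V x.2.2.1).carrier) : ℚ))
        * (hallP A (V x.2.1).carrier (V x.1).carrier K : ℚ)
        * (hallP A (V x.2.2.2).carrier (V x.2.2.1).carrier L : ℚ)
        * (hallP A (V x.2.1).carrier (V x.2.2.2).carrier M : ℚ)
        * (hallP A (V x.1).carrier (V x.2.2.1).carrier N : ℚ)
        / ((autCard A (V x.1).carrier : ℚ) * (autCard A (V x.2.1).carrier : ℚ)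
            * (autCard A (V x.2.2.1).carrier : ℚ)
            * (autCard A (V x.2.2.2).carrier : ℚ))).Finite ∧
    (∑ᶠ J : ι, (1 / (autCard A (V J).carrier : ℚ)) * (hallP A M N (V J).carrier : ℚ)
        * (hallP A K L (V J).carrier : ℚ))
      = ∑ᶠ x : ι × ι × ι × ι,
          ((Nat.card (Abelian.Ext (ModuleCat.of A (V x.2.1).carrier)
                (ModuleCat.of A (V x.2.2.1).carrier) 1) : ℚ)
              / (Nat.card ((V x.2.1).carrier →ₗ[A] (V x.2.2.1).carrier) : ℚ))
            * (hallP A (V x.2.1).carrier (V x.1).carrier K : ℚ)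
            * (hallP A (V x.2.2.2).carrier (V x.2.2.1).carrier L : ℚ)
            * (hallP A (V x.2.1).carrier (V x.2.2.2).carrier M : ℚ)
            * (hallP A (V x.1).carrier (V x.2.2.1).carrier N : ℚ)
            / ((autCard A (V x.1).carrier : ℚ) * (autCard A (V x.2.1).carrier : ℚ)
                * (autCard A (V x.2.2.1).carrier : ℚ)
                * (autCard A (V x.2.2.2).carrier : ℚ)) := by
  let T := (finite_setOf_card_le hrep
    (Nat.card M + Nat.card K + Nat.card L + Nat.card M * Nat.card N)).toFinset
  have hT : ∀ i, Nat.card (V i).carrier ≤ Nat.card M + Nat.card K + Nat.card L → i ∈ T :=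
    fun i hi => (Set.Finite.mem_toFinset _).2 (le_add_right hi)
  have hT' : ∀ i, Nat.card (V i).carrier = Nat.card M * Nat.card N → i ∈ T :=
    fun i hi => (Set.Finite.mem_toFinset _).2 (hi.trans_le (Nat.le_add_left _ _))
  have hL : (Function.support fun J : ι =>
      (1 / (autCard A (V J).carrier : ℚ)) * (hallP A M N (V J).carrier : ℚ)
        * (hallP A K L (V J).carrier : ℚ)) ⊆ T := fun J hJ => by
    obtain ⟨s⟩ := nonempty_SES_of_hallP_ne_zero (right_ne_zero_of_mul (left_ne_zero_of_mul hJ))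
    exact hT' J s.card_eq
  have hR : (Function.support fun x : ι × ι × ι × ι =>
      ((Nat.card (Abelian.Ext (ModuleCat.of A (V x.2.1).carrier)
            (ModuleCat.of A (V x.2.2.1).carrier) 1) : ℚ)
          / (Nat.card ((V x.2.1).carrier →ₗ[A] (V x.2.2.1).carrier) : ℚ))
        * (hallP A (V x.2.1).carrier (V x.1).carrier K : ℚ)
        * (hallP A (V x.2.2.2).carrier (V x.2.2.1).carrier L : ℚ)
        * (hallP A (V x.2.1).carrier (V x.2.2.2).carrier M : ℚ)
        * (hallP A (V x.1).carrier (V x.2.2.1).carrier N : ℚ)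
        / ((autCard A (V x.1).carrier : ℚ) * (autCard A (V x.2.1).carrier : ℚ)
            * (autCard A (V x.2.2.1).carrier : ℚ)
            * (autCard A (V x.2.2.2).carrier : ℚ))) ⊆ ↑(T ×ˢ T ×ˢ T ×ˢ T) := fun x hx => by
    have h1 := left_ne_zero_of_mul (div_ne_zero_iff.1 hx).1
    have h2 := left_ne_zero_of_mul h1
    obtain ⟨s₁⟩ := nonempty_SES_of_hallP_ne_zero (right_ne_zero_of_mul (left_ne_zero_of_mul h2))
    obtain ⟨s₂⟩ := nonempty_SES_of_hallP_ne_zero (right_ne_zero_of_mul h2)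
    have c₁ := Nat.card_le_card_of_injective _ s₁.inj
    have c₂ := Nat.card_le_card_of_surjective _ s₁.surj
    have c₃ := Nat.card_le_card_of_injective _ s₂.inj
    have c₄ := Nat.card_le_card_of_surjective _ s₂.surj
    simp only [Finset.coe_product, Set.mem_prod, Finset.mem_coe]
    exact ⟨hT _ (by omega), hT _ (by omega), hT _ (by omega), hT _ (by omega)⟩
  refine ⟨T.finite_toSet.subset hL, (Finset.finite_toSet _).subset hR, ?_⟩
  rw [finsum_eq_sum_of_support_subset _ hL, finsum_eq_sum_of_support_subset _ hR]
  refine Eq.trans (Finset.sum_congr rfl fun J _ => ?_)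
    ((sum_card_cross hhered hrep hT hT').trans (Finset.sum_congr rfl fun x _ => ?_))
  · rw [Nat.card_prod, Nat.cast_mul, one_div_mul_eq_div, div_mul_eq_mul_div]
    rfl
  · simp only [Nat.card_prod, Nat.cast_mul, ← mul_assoc]
    rfl
end

section
/- Let k be a field, V a finite-dimensional k-vector space, x a k-linear endomorphism of V, and R a subspace of ker(x) (so R is x-invariant); let y denote the endomorphism of V/R induced by x. Then for every i ≥ 0, dim ker(y^i) = dim ker(x^i) − dim R + dim(R ∩ im(x^i)). Consequently, if x is nilpotent and, for a nilpotent endomorphism z, b_i(z) := 2·dim ker(z^i) − dim ker(z^{i−1}) − dim ker(z^{i+1}) denotes the number of Jordan blocks of z of size i, then for every i ≥ 1 one has b_i(y) = b_i(x) + 2ρ_i − ρ_{i−1} − ρ_{i+1}, where ρ_j := dim(R ∩ im(x^j)). -/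
/-- If `g` on `V ⧸ R` lifts to `f` on `V`, the dimension of `ker g` is determined by those of
`ker f`, `R` and `R ⊓ range f`. -/
theorem finrank_ker_add_finrank_of_comp_mkQ {K E : Type*} [Field K] [AddCommGroup E] [Module K E]
    [FiniteDimensional K E] (R : Submodule K E) (f : E →ₗ[K] E) (g : (E ⧸ R) →ₗ[K] (E ⧸ R))
    (h : g ∘ₗ R.mkQ = R.mkQ ∘ₗ f) :
    Module.finrank K (LinearMap.ker g) + Module.finrank K R =
      Module.finrank K (LinearMap.ker f) +
        Module.finrank K ↥(R ⊓ LinearMap.range f) := by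
  have hrange : LinearMap.range g = LinearMap.range (R.mkQ.domRestrict (LinearMap.range f)) := by
    rw [LinearMap.range_domRestrict, ← LinearMap.range_comp, ← h, LinearMap.range_comp,
      R.range_mkQ, LinearMap.range_eq_map]
  have hker : Module.finrank K (LinearMap.ker (R.mkQ.domRestrict (LinearMap.range f))) =
      Module.finrank K ↥(R ⊓ LinearMap.range f) := by
    rw [LinearMap.ker_domRestrict, R.ker_mkQ, inf_comm, ← Submodule.map_comap_subtype,
      Submodule.finrank_map_subtype_eq]
  have hg := g.finrank_range_add_finrank_ker
  have hf := f.finrank_range_add_finrank_ker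
  have hmk := (R.mkQ.domRestrict (LinearMap.range f)).finrank_range_add_finrank_ker
  have hR := R.finrank_quotient_add_finrank
  rw [hrange] at hg
  omega

/-- For a finite-dimensional vector space `V`, an endomorphism `x`, a subspace
`R ⊆ ker x`, and the endomorphism `y` induced by `x` on `V/R`:
`dim ker(y^i) = dim ker(x^i) - dim R + dim (R ∩ im(x^i))` for all `i ≥ 0`; consequently,
when `x` is nilpotent, the numbers `b_i(z) = 2·dim ker(z^i) - dim ker(z^{i-1}) -
dim ker(z^{i+1})` of Jordan blocks of size `i` satisfy
`b_i(y) = b_i(x) + 2ρ_i - ρ_{i-1} - ρ_{i+1}` with `ρ_j = dim (R ∩ im(x^j))`, for `i ≥ 1`. -/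
theorem finrank_ker_pow_quotient_by_sub_of_ker
    (k V : Type) [Field k] [AddCommGroup V] [Module k V] [FiniteDimensional k V]
    (x : V →ₗ[k] V) (R : Submodule k V) (hR : R ≤ LinearMap.ker x)
    (y : (V ⧸ R) →ₗ[k] (V ⧸ R))
    (hy : ∀ v : V, y (Submodule.Quotient.mk v) = Submodule.Quotient.mk (x v)) :
    (∀ i : ℕ,
      (Module.finrank k (LinearMap.ker (y ^ i)) : ℤ)
        = (Module.finrank k (LinearMap.ker (x ^ i)) : ℤ)
          - (Module.finrank k R : ℤ)
          + (Module.finrank k ↥(R ⊓ LinearMap.range (x ^ i)) : ℤ)) ∧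
    (IsNilpotent x → ∀ i : ℕ, 1 ≤ i →
      (2 * (Module.finrank k (LinearMap.ker (y ^ i)) : ℤ)
          - (Module.finrank k (LinearMap.ker (y ^ (i - 1))) : ℤ)
          - (Module.finrank k (LinearMap.ker (y ^ (i + 1))) : ℤ))
        = (2 * (Module.finrank k (LinearMap.ker (x ^ i)) : ℤ)
            - (Module.finrank k (LinearMap.ker (x ^ (i - 1))) : ℤ)
            - (Module.finrank k (LinearMap.ker (x ^ (i + 1))) : ℤ))
          + 2 * (Module.finrank k ↥(R ⊓ LinearMap.range (x ^ i)) : ℤ)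
          - (Module.finrank k ↥(R ⊓ LinearMap.range (x ^ (i - 1))) : ℤ)
          - (Module.finrank k ↥(R ⊓ LinearMap.range (x ^ (i + 1))) : ℤ)) := by
  have hcomp (i : ℕ) : (y ^ i) ∘ₗ R.mkQ = R.mkQ ∘ₗ (x ^ i) :=
    Module.End.commute_pow_left_of_commute (LinearMap.ext hy) i
  have hker (i : ℕ) := finrank_ker_add_finrank_of_comp_mkQ R (x ^ i) (y ^ i) (hcomp i)
  refine ⟨fun i => ?_, fun _ i _ => ?_⟩
  · have := hker i
    omega
  · have := hker i
    have := hker (i - 1)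
    have := hker (i + 1)
    omega
end

section
/- Let k be a finite field with q elements, K a finite-dimensional k-vector space, and K = K_0 ⊇ K_1 ⊇ ⋯ ⊇ K_n = 0 a chain of subspaces; set l_i := dim K_{i−1} − dim K_i for 1 ≤ i ≤ n. Let r_0 ≥ r_1 ≥ ⋯ ≥ r_n = 0 be integers. Then the number of k-subspaces R ⊆ K with dim(R ∩ K_i) = r_i for all 0 ≤ i ≤ n equals q^t · ∏_{i=1}^{n} G_q(l_i, r_{i−1} − r_i), where t := Σ_{j=1}^{n} (r_{j−1} − r_j)·(dim K_j − r_j). -/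
/-- `gaussBinom k l s` is the Gaussian binomial coefficient: the number of `s`-dimensional
`k`-subspaces of an `l`-dimensional `k`-vector space. -/
noncomputable def gaussBinom (k : Type) [Field k] (l s : ℕ) : ℕ :=
  Nat.card {W : Submodule k (Fin l → k) // Module.finrank k W = s}

open Module

theorem card_submodule_finrank_eq (k : Type) [Field k] (V : Type*) [AddCommGroup V] [Module k V]
    [FiniteDimensional k V] (s : ℕ) :
    Nat.card {W : Submodule k V // finrank k W = s} = gaussBinom k (finrank k V) s := by
  let e : V ≃ₗ[k] (Fin (finrank k V) → k) := (finBasis k V).equivFun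
  exact Nat.card_congr <| (Submodule.orderIsoMapComap e).toEquiv.subtypeEquiv fun W ↦ by
    rw [← e.finrank_map_eq W]; rfl

/-- A linear map is determined by its graph, and the graphs are the subspaces of the product
meeting the second factor trivially. -/
noncomputable def LinearPMap.equivGraph (k E F : Type*) [Field k] [AddCommGroup E] [Module k E]
    [AddCommGroup F] [Module k F] :
    (E →ₗ.[k] F) ≃ {g : Submodule k (E × F) // ∀ x ∈ g, x.1 = 0 → x.2 = 0} where
  toFun f := ⟨f.graph, fun _ hx h0 ↦ f.graph_fst_eq_zero_snd hx h0⟩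
  invFun g := g.1.toLinearPMap
  left_inv f := LinearPMap.eq_of_eq_graph <| Submodule.toLinearPMap_graph_eq _
    fun _ hx h0 ↦ f.graph_fst_eq_zero_snd hx h0
  right_inv g := Subtype.ext <| Submodule.toLinearPMap_graph_eq _ g.2

theorem LinearPMap.finrank_graph {k E F : Type*} [Field k] [AddCommGroup E] [Module k E]
    [AddCommGroup F] [Module k F] (f : E →ₗ.[k] F) : finrank k f.graph = finrank k f.domain := by
  have hinj : Function.Injective ((LinearMap.fst k E F).domRestrict f.graph) := by
    rw [← LinearMap.ker_eq_bot, LinearMap.ker_eq_bot']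
    rintro ⟨⟨x, y⟩, hxy⟩ h
    have hx : x = 0 := h
    have hy := f.graph_fst_eq_zero_snd hxy hx
    simp [hx, hy]
  rw [← LinearMap.finrank_range_of_inj hinj, LinearMap.range_domRestrict,
    f.graph_map_fst_eq_domain]

theorem Nat.card_sigma_of_forall_eq {α : Type*} {β : α → Type*} [Finite α] [∀ a, Finite (β a)]
    {c : ℕ} (h : ∀ a, Nat.card (β a) = c) : Nat.card (Σ a, β a) = Nat.card α * c := by
  have := Fintype.ofFinite α
  simp [Nat.card_sigma, h]

theorem card_linearPMap_finrank_domain_eq (k : Type) [Field k] [Fintype k] (E F : Type*)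
    [AddCommGroup E] [Module k E] [FiniteDimensional k E]
    [AddCommGroup F] [Module k F] [FiniteDimensional k F] (s : ℕ) :
    Nat.card {f : E →ₗ.[k] F // finrank k f.domain = s}
      = gaussBinom k (finrank k E) s * Fintype.card k ^ (s * finrank k F) := by
  have := Module.finite_of_finite k (M := E)
  have (D : Submodule k E) : Finite (D →ₗ[k] F) := Module.finite_of_finite k
  rw [← card_submodule_finrank_eq k E s]
  let e : {f : E →ₗ.[k] F // finrank k f.domain = s} ≃
      Σ D : {D : Submodule k E // finrank k D = s}, (D.1 →ₗ[k] F) :=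
    { toFun f := ⟨⟨f.1.domain, f.2⟩, f.1.toFun⟩
      invFun p := ⟨⟨p.1.1, p.2⟩, p.1.2⟩
      left_inv _ := rfl
      right_inv _ := rfl }
  rw [Nat.card_congr e]
  refine Nat.card_sigma_of_forall_eq fun D ↦ ?_
  rw [Module.natCard_eq_pow_finrank (K := k), Module.finrank_linearMap, D.2,
    Nat.card_eq_fintype_card]

theorem card_submodule_inf_eq_bot (k : Type) [Field k] [Fintype k] (V : Type*)
    [AddCommGroup V] [Module k V] [FiniteDimensional k V] (U : Submodule k V) (s : ℕ) :
    Nat.card {S : Submodule k V // S ⊓ U = ⊥ ∧ finrank k S = s}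
      = gaussBinom k (finrank k V - finrank k U) s * Fintype.card k ^ (s * finrank k U) := by
  obtain ⟨C, hC⟩ := U.exists_isCompl
  have hdim : finrank k V - finrank k U = finrank k C := by
    have := Submodule.finrank_add_eq_of_isCompl hC
    omega
  rw [hdim, ← card_linearPMap_finrank_domain_eq k C U s]
  let e := C.prodEquivOfIsCompl U hC.symm
  let e₁ : {f : C →ₗ.[k] U // finrank k f.domain = s} ≃
      {g : {g : Submodule k (C × U) // ∀ x ∈ g, x.1 = 0 → x.2 = 0} // finrank k g.1 = s} :=
    (LinearPMap.equivGraph k C U).subtypeEquiv fun f ↦ by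
      rw [← f.finrank_graph]; rfl
  let e₂ : {g : {g : Submodule k (C × U) // ∀ x ∈ g, x.1 = 0 → x.2 = 0} // finrank k g.1 = s} ≃
      {g : Submodule k (C × U) // (∀ x ∈ g, x.1 = 0 → x.2 = 0) ∧ finrank k g = s} :=
    Equiv.subtypeSubtypeEquivSubtypeInter _ fun g : Submodule k (C × U) ↦ finrank k g = s
  let e₃ : {g : Submodule k (C × U) // (∀ x ∈ g, x.1 = 0 → x.2 = 0) ∧ finrank k g = s} ≃
      {S : Submodule k V // S ⊓ U = ⊥ ∧ finrank k S = s} :=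
    (Submodule.orderIsoMapComap e).toEquiv.subtypeEquiv fun g ↦ by
      refine and_congr ?_ (by rw [← e.finrank_map_eq g]; rfl)
      rw [← disjoint_iff, Submodule.disjoint_def]
      constructor
      · rintro h _ ⟨x, hx, rfl⟩ hU
        have h0 := (Submodule.prodEquivOfIsCompl_symm_apply_fst_eq_zero C U hC.symm).2 hU
        have h1 : x.1 = 0 := by simpa [e] using h0
        have h2 : x = 0 := Prod.ext h1 (h x hx h1)
        simp [h2]
      · intro h x hx h1
        have := h (e x) ⟨x, hx, rfl⟩ (by simp [e, h1])
        rw [e.map_eq_zero_iff.1 this]; rfl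
  exact Nat.card_congr ((e₁.trans e₂).trans e₃).symm

theorem Submodule.finrank_comap_mkQ {k V : Type*} [Field k] [AddCommGroup V] [Module k V]
    [FiniteDimensional k V] (T : Submodule k V) (S : Submodule k (V ⧸ T)) :
    finrank k (S.comap T.mkQ) = finrank k S + finrank k T := by
  have h := (T.mkQ.domRestrict (S.comap T.mkQ)).finrank_range_add_finrank_ker
  rw [LinearMap.range_domRestrict, Submodule.map_comap_eq_self (by simp),
    LinearMap.ker_domRestrict, Submodule.ker_mkQ] at h
  rw [← h, (Submodule.comapSubtypeEquivOfLe (Submodule.le_comap_mkQ T S)).finrank_eq]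

/-- The number of `s`-dimensional subspaces whose intersection with `U` is a given `T ≤ U`. -/
theorem card_submodule_inf_eq (k : Type) [Field k] [Fintype k] (V : Type*)
    [AddCommGroup V] [Module k V] [FiniteDimensional k V] {U T : Submodule k V} (hT : T ≤ U)
    {s : ℕ} (hs : finrank k T ≤ s) :
    Nat.card {S : Submodule k V // S ⊓ U = T ∧ finrank k S = s}
      = gaussBinom k (finrank k V - finrank k U) (s - finrank k T) *
        Fintype.card k ^ ((s - finrank k T) * (finrank k U - finrank k T)) := by
  have hU : finrank k (U.map T.mkQ) + finrank k T = finrank k U := by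
    rw [← Submodule.finrank_comap_mkQ, Submodule.comap_map_mkQ, sup_eq_right.2 hT]
  have hV := T.finrank_quotient_add_finrank
  have h := card_submodule_inf_eq_bot k (V ⧸ T) (U.map T.mkQ) (s - finrank k T)
  rw [show finrank k (V ⧸ T) - finrank k (U.map T.mkQ) = finrank k V - finrank k U by omega,
    show finrank k (U.map T.mkQ) = finrank k U - finrank k T by omega] at h
  rw [← h]
  let e₁ : {S : Submodule k (V ⧸ T) // S ⊓ U.map T.mkQ = ⊥ ∧ finrank k S = s - finrank k T} ≃
      {S : Set.Ici T // S.1 ⊓ U = T ∧ finrank k S.1 = s} :=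
    (Submodule.comapMkQRelIso T).toEquiv.subtypeEquiv fun S ↦ by
      change _ ↔ S.comap T.mkQ ⊓ U = T ∧ finrank k (S.comap T.mkQ) = s
      rw [Submodule.finrank_comap_mkQ]
      refine and_congr ?_ (by omega)
      have hcomap : S.comap T.mkQ ⊓ U = (S ⊓ U.map T.mkQ).comap T.mkQ := by
        rw [Submodule.comap_inf, Submodule.comap_map_mkQ, sup_eq_right.2 hT]
      have hbot : T = (⊥ : Submodule k (V ⧸ T)).comap T.mkQ := by
        rw [Submodule.comap_bot, Submodule.ker_mkQ]
      rw [hcomap]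
      conv_rhs => rhs; rw [hbot]
      exact (Submodule.comap_injective_of_surjective T.mkQ_surjective).eq_iff.symm
  let e₂ : {S : Set.Ici T // S.1 ⊓ U = T ∧ finrank k S.1 = s} ≃
      {S : Submodule k V // S ⊓ U = T ∧ finrank k S = s} :=
    Equiv.subtypeSubtypeEquivSubtype fun {S} (h : S ⊓ U = T ∧ finrank k S = s) ↦
      Set.mem_Ici.2 (h.1 ▸ inf_le_left)
  exact Nat.card_congr (e₁.trans e₂).symm

/-- The count of subspaces with prescribed intersections with a flag, indexed from zero. -/
theorem card_submodule_flag_intersections_range (k : Type) [Field k] [Fintype k] (n : ℕ) :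
    ∀ (K : Type) [AddCommGroup K] [Module k K] [FiniteDimensional k K]
    (Kc : ℕ → Submodule k K) (_ : Kc 0 = ⊤) (_ : Kc n = ⊥) (_ : ∀ i < n, Kc (i + 1) ≤ Kc i)
    (r : ℕ → ℕ) (_ : ∀ i < n, r (i + 1) ≤ r i) (_ : r n = 0),
    Nat.card {R : Submodule k K // ∀ i ≤ n, finrank k ↥(R ⊓ Kc i) = r i}
      = Fintype.card k ^
          (∑ j ∈ Finset.range n, (r j - r (j + 1)) * (finrank k ↥(Kc (j + 1)) - r (j + 1)))
        * ∏ i ∈ Finset.range n,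
            gaussBinom k (finrank k ↥(Kc i) - finrank k ↥(Kc (i + 1))) (r i - r (i + 1)) := by
  induction n with
  | zero =>
    intro K _ _ _ Kc h0 hn _ r _ hr
    have : Subsingleton (Submodule k K) := subsingleton_of_bot_eq_top (hn.symm.trans h0)
    simp only [Finset.range_zero, Finset.sum_empty, pow_zero, Finset.prod_empty, mul_one]
    rw [Nat.card_eq_one_iff_unique]
    refine ⟨inferInstance, ⟨⊥, fun i hi ↦ ?_⟩⟩
    obtain rfl := Nat.le_zero.1 hi
    rw [bot_inf_eq, finrank_bot, hr]
  | succ n ih =>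
    intro K _ _ _ Kc h0 hn hK r hr hrn
    have hle : ∀ i ≤ n, Kc (i + 1) ≤ Kc 1 := by
      intro i hi
      induction i with
      | zero => exact le_rfl
      | succ i ihi => exact (hK (i + 1) (by omega)).trans (ihi (by omega))
    have hfin : ∀ i ≤ n, finrank k ((Kc (i + 1)).submoduleOf (Kc 1)) = finrank k (Kc (i + 1)) :=
      fun i hi ↦ (Submodule.submoduleOfEquivOfLe (hle i hi)).finrank_eq
    have ih' := ih (Kc 1) (fun i ↦ (Kc (i + 1)).submoduleOf (Kc 1)) (by simp [Submodule.submoduleOf])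
      (by simp [Submodule.submoduleOf, hn])
      (fun i hi ↦ Submodule.comap_mono (hK (i + 1) (by omega)))
      (fun i ↦ r (i + 1)) (fun i hi ↦ hr (i + 1) (by omega)) hrn
    have hsum : ∑ j ∈ Finset.range n, (r (j + 1) - r (j + 1 + 1)) *
          (finrank k ((Kc (j + 1 + 1)).submoduleOf (Kc 1)) - r (j + 1 + 1)) =
        ∑ j ∈ Finset.range n, (r (j + 1) - r (j + 1 + 1)) *
          (finrank k (Kc (j + 1 + 1)) - r (j + 1 + 1)) :=
      Finset.sum_congr rfl fun j hj ↦ by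
        rw [hfin (j + 1) (by simpa using hj)]
    have hprod : ∏ i ∈ Finset.range n, gaussBinom k
          (finrank k ((Kc (i + 1)).submoduleOf (Kc 1)) -
            finrank k ((Kc (i + 1 + 1)).submoduleOf (Kc 1))) (r (i + 1) - r (i + 1 + 1)) =
        ∏ i ∈ Finset.range n, gaussBinom k
          (finrank k (Kc (i + 1)) - finrank k (Kc (i + 1 + 1))) (r (i + 1) - r (i + 1 + 1)) :=
      Finset.prod_congr rfl fun j hj ↦ by
        have hj := Finset.mem_range.1 hj
        rw [hfin (j + 1) hj, hfin j hj.le]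
    rw [hsum, hprod] at ih'
    have := Module.finite_of_finite k (M := K)
    have hinf : ∀ (T : Submodule k (Kc 1)) (R : Submodule k K), R ⊓ Kc 1 = T.map (Kc 1).subtype →
        ∀ i ≤ n, finrank k ↥(T ⊓ (Kc (i + 1)).submoduleOf (Kc 1)) = finrank k ↥(R ⊓ Kc (i + 1)) := by
      intro T R hTR i hi
      rw [← Submodule.finrank_map_subtype_eq (Kc 1), Submodule.submoduleOf,
        Submodule.map_inf _ (Kc 1).injective_subtype, ← hTR, Submodule.map_comap_subtype,
        ← inf_assoc, inf_assoc R, inf_idem, inf_assoc, inf_eq_right.2 (hle i hi)]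
    have hmap : ∀ R : Submodule k K, R ⊓ Kc 1 = (R.submoduleOf (Kc 1)).map (Kc 1).subtype :=
      fun R ↦ by rw [Submodule.submoduleOf, Submodule.map_comap_subtype, inf_comm]
    let e : {R : Submodule k K // ∀ i ≤ n + 1, finrank k ↥(R ⊓ Kc i) = r i} ≃
        Σ T : {T : Submodule k (Kc 1) //
            ∀ i ≤ n, finrank k ↥(T ⊓ (Kc (i + 1)).submoduleOf (Kc 1)) = r (i + 1)},
          {S : Submodule k K // S ⊓ Kc 1 = T.1.map (Kc 1).subtype ∧ finrank k S = r 0} :=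
      { toFun R := ⟨⟨R.1.submoduleOf (Kc 1), fun i hi ↦ by
            rw [hinf _ R.1 (hmap R.1) i hi, R.2 _ (by omega)]⟩,
          ⟨R.1, hmap R.1, by
            rw [← R.2 0 (by omega), h0, inf_top_eq]⟩⟩
        invFun p := ⟨p.2.1, fun i hi ↦ by
          rcases i with _ | i
          · rw [h0, inf_top_eq, p.2.2.2]
          · rw [← hinf _ _ p.2.2.1 i (by omega), p.1.2 i (by omega)]⟩
        left_inv _ := rfl
        right_inv := by
          rintro ⟨⟨T, hT⟩, ⟨S, hS, hS'⟩⟩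
          obtain rfl : T = S.submoduleOf (Kc 1) := by
            apply Submodule.map_injective_of_injective (Kc 1).injective_subtype
            rw [← hS, hmap]
          rfl }
    rw [Nat.card_congr e, Nat.card_sigma_of_forall_eq
      (c := gaussBinom k (finrank k K - finrank k (Kc 1)) (r 0 - r 1) *
        Fintype.card k ^ ((r 0 - r 1) * (finrank k (Kc 1) - r 1))), ih',
      Finset.sum_range_succ', Finset.prod_range_succ', pow_add, h0, finrank_top]
    · ring
    · intro T
      have hT : finrank k (T.1.map (Kc 1).subtype) = r 1 := by
        have htop : T.1 ⊓ (Kc (0 + 1)).submoduleOf (Kc 1) = T.1 := inf_eq_left.2 fun x _ ↦ x.2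
        have h := T.2 0 (by omega)
        rw [htop] at h
        rw [Submodule.finrank_map_subtype_eq, h]
      rw [← hT]
      exact card_submodule_inf_eq k K (Submodule.map_subtype_le _ _) (hT ▸ hr 0 (by omega))

/-- Let `k` be a finite field with `q` elements, `K` a finite-dimensional `k`-vector space
and `K = K₀ ⊇ K₁ ⊇ ⋯ ⊇ Kₙ = 0` a chain of subspaces, `l_i = dim K_{i-1} - dim K_i`.
For integers `r₀ ≥ r₁ ≥ ⋯ ≥ rₙ = 0`, the number of subspaces `R ⊆ K` with
`dim (R ∩ K_i) = r_i` for all `0 ≤ i ≤ n` equals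
`q^t · ∏_{i=1}^n G_q(l_i, r_{i-1} - r_i)` where
`t = Σ_{j=1}^n (r_{j-1} - r_j)·(dim K_j - r_j)`. -/
theorem card_subspaces_with_flag_intersections
    (k : Type) [Field k] [Fintype k]
    (K : Type) [AddCommGroup K] [Module k K] [FiniteDimensional k K]
    (n : ℕ) (Kc : ℕ → Submodule k K)
    (hK0 : Kc 0 = ⊤) (hKn : Kc n = ⊥) (hKchain : ∀ i < n, Kc (i + 1) ≤ Kc i)
    (r : ℕ → ℕ) (hr : ∀ i < n, r (i + 1) ≤ r i) (hrn : r n = 0) :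
    Nat.card {R : Submodule k K // ∀ i ≤ n, Module.finrank k ↥(R ⊓ Kc i) = r i}
      = Fintype.card k ^
          (∑ j ∈ Finset.Icc 1 n, (r (j - 1) - r j) * (Module.finrank k ↥(Kc j) - r j))
        * ∏ i ∈ Finset.Icc 1 n,
            gaussBinom k (Module.finrank k ↥(Kc (i - 1)) - Module.finrank k ↥(Kc i))
              (r (i - 1) - r i) := by
  rw [card_submodule_flag_intersections_range k n K Kc hK0 hKn hKchain r hr hrn]
  have h : Finset.Icc 1 n = Finset.Ico (0 + 1) (n + 1) := by
    ext; simp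
  rw [h, ← Finset.sum_Ico_add', ← Finset.prod_Ico_add', Finset.range_eq_Ico]
  rfl
end

section
/- Let k be a finite field and let (M,x_M), (N,x_N), (R,x_R) be finite-dimensional k-vector spaces, each equipped with a nilpotent k-linear endomorphism. Then the number of x_R-invariant subspaces L ⊆ R such that (L, x_R restricted to L) is isomorphic to (N,x_N) and (R/L, the induced endomorphism) is isomorphic to (M,x_M) equals the number of x_R-invariant subspaces L ⊆ R such that (L, x_R restricted to L) is isomorphic to (M,x_M) and (R/L, the induced endomorphism) is isomorphic to (N,x_N). (This is the commutativity of Steinitz's classical Hall algebra.) -/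
/-- `hallPairCount k xM xN xR` counts the `xR`-invariant subspaces `L ⊆ R` such that the
pair `(L, xR|_L)` is isomorphic to `(N, xN)` and the induced pair `(R/L, induced map)` is
isomorphic to `(M, xM)`. -/
noncomputable def hallPairCount (k : Type) [Field k]
    {M N R : Type} [AddCommGroup M] [Module k M] [AddCommGroup N] [Module k N]
    [AddCommGroup R] [Module k R]
    (xM : M →ₗ[k] M) (xN : N →ₗ[k] N) (xR : R →ₗ[k] R) : ℕ :=
  Nat.card {L : Submodule k R // ∃ hL : ∀ v ∈ L, xR v ∈ L,
    (∃ e : ↥L ≃ₗ[k] N, ∀ (v : R) (hv : v ∈ L), e ⟨xR v, hL v hv⟩ = xN (e ⟨v, hv⟩)) ∧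
    (∃ f : (R ⧸ L) ≃ₗ[k] M, ∀ v : R,
      f (Submodule.Quotient.mk (xR v)) = xM (f (Submodule.Quotient.mk v)))}

open Polynomial in
/-- A nonzero quotient of `k[X]` is a Frobenius algebra: it carries a linear form whose kernel
contains no nonzero ideal. -/
theorem Polynomial.exists_linearForm_quotient {k : Type*} [Field k] (I : Ideal k[X])
    (hI : I ≠ ⊥) :
    ∃ l : (k[X] ⧸ I) →ₗ[k] k, ∀ a, (∀ b, l (a * b) = 0) → a = 0 := by
  classical
  obtain ⟨g, hg, rfl⟩ : ∃ g : k[X], g.Monic ∧ I = Ideal.span {g} := by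
    obtain ⟨f, rfl⟩ := (IsPrincipalIdealRing.principal I).principal
    have hf : f ≠ 0 := by
      rintro rfl
      simp at hI
    refine ⟨normalize f, Polynomial.monic_normalize hf, ?_⟩
    exact Ideal.span_singleton_eq_span_singleton.mpr (associated_normalize f)
  refine ⟨(Polynomial.lcoeff k (g.natDegree - 1)).comp (AdjoinRoot.modByMonicHom hg), ?_⟩
  intro a ha
  obtain ⟨p, rfl⟩ := Ideal.Quotient.mk_surjective a
  rw [Ideal.Quotient.eq_zero_iff_dvd, ← Polynomial.modByMonic_eq_zero_iff_dvd hg]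
  by_contra hr
  set r := p %ₘ g with hr_def
  have hdeg : r.degree < g.degree := Polynomial.degree_modByMonic_lt p hg
  have hlt : r.natDegree < g.natDegree := Polynomial.natDegree_lt_natDegree hr hdeg
  have hpr : Ideal.Quotient.mk (Ideal.span {g}) p = Ideal.Quotient.mk (Ideal.span {g}) r := by
    rw [Ideal.Quotient.eq, Ideal.mem_span_singleton, hr_def,
      Polynomial.modByMonic_eq_sub_mul_div, sub_sub_cancel]
    exact dvd_mul_right _ _
  have h := ha (Ideal.Quotient.mk _ (X ^ (g.natDegree - 1 - r.natDegree)))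
  rw [hpr, ← map_mul] at h
  have h' : (r * X ^ (g.natDegree - 1 - r.natDegree) %ₘ g).coeff (g.natDegree - 1) = 0 := h
  have hself : r * X ^ (g.natDegree - 1 - r.natDegree) %ₘ g =
      r * X ^ (g.natDegree - 1 - r.natDegree) := by
    rw [Polynomial.modByMonic_eq_self_iff hg]
    apply Polynomial.degree_lt_degree
    rw [Polynomial.natDegree_mul_X_pow _ hr]
    omega
  rw [hself, Polynomial.coeff_mul_X_pow', if_pos (by omega),
    show g.natDegree - 1 - (g.natDegree - 1 - r.natDegree) = r.natDegree by omega] at h'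
  exact hr (Polynomial.leadingCoeff_eq_zero.mp h')

universe u in
open Polynomial in
/-- Coordinates of an endomorphism of a finite-dimensional space with respect to a decomposition
into cyclic `k[X]`-modules. -/
theorem LinearMap.exists_cyclic_coordinates {k : Type u} {V : Type*} [Field k] [AddCommGroup V] [Module k V]
    [FiniteDimensional k V] (x : V →ₗ[k] V) :
    ∃ (ι : Type u) (_ : Fintype ι) (I : ι → Ideal k[X]) (_ : ∀ i, I i ≠ ⊥)
      (c : ∀ i, V →ₗ[k] k[X] ⧸ I i),
      (∀ i v, c i (x v) = Ideal.Quotient.mk (I i) X * c i v) ∧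
      (∀ v, (∀ i, c i v = 0) → v = 0) ∧
      ∀ i b, ∃ w, c i w = b ∧ ∀ j, j ≠ i → c j w = 0 := by
  classical
  obtain ⟨ι, hι, p, hp, e, ⟨ψ⟩⟩ := Module.equiv_directSum_of_isTorsion
    (Module.AEval.isTorsion_of_finiteDimensional k V x)
  refine ⟨ι, hι, fun i => Ideal.span {p i ^ e i}, fun i => ?_, fun i =>
    { toFun := fun v => ψ (Module.AEval'.of x v) i
      map_add' := fun v w => by simp
      map_smul' := fun t v => ?_ }, fun i v => ?_, fun v hv => ?_, fun i b => ?_⟩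
  · simpa using fun h => absurd h (hp i).ne_zero
  · rw [map_smul, ← algebraMap_smul k[X] t (Module.AEval'.of x v), map_smul]
    exact algebraMap_smul k[X] t (ψ (Module.AEval'.of x v) i)
  · change ψ (Module.AEval'.of x (x v)) i = _
    rw [← Module.AEval'.X_smul_of, map_smul]
    rfl
  · have h : ψ (Module.AEval'.of x v) = 0 := DFinsupp.ext hv
    simpa using h
  · refine ⟨(Module.AEval'.of x).symm (ψ.symm (DirectSum.of
      (fun i => k[X] ⧸ Submodule.span k[X] {p i ^ e i}) i b)), ?_, fun j hj => ?_⟩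
    · simp only [LinearMap.coe_mk, AddHom.coe_mk, LinearEquiv.apply_symm_apply]
      exact DirectSum.of_eq_same (β := fun i => k[X] ⧸ Submodule.span k[X] {p i ^ e i}) i b
    · simp only [LinearMap.coe_mk, AddHom.coe_mk, LinearEquiv.apply_symm_apply]
      exact DirectSum.of_eq_of_ne (β := fun i => k[X] ⧸ Submodule.span k[X] {p i ^ e i}) i j b hj

/-- An endomorphism of a finite-dimensional space is isomorphic to its transpose. -/
theorem LinearMap.exists_equiv_dual_intertwining {k V : Type*} [Field k] [AddCommGroup V]
    [Module k V] [FiniteDimensional k V] (x : V →ₗ[k] V) :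
    ∃ φ : V ≃ₗ[k] Module.Dual k V, ∀ v, φ (x v) = x.dualMap (φ v) := by
  obtain ⟨ι, _, I, hI, c, hcx, hc, hcs⟩ := x.exists_cyclic_coordinates
  choose l hl using fun i => Polynomial.exists_linearForm_quotient (I i) (hI i)
  let B : V →ₗ[k] Module.Dual k V :=
    ∑ i, ((LinearMap.mul k (Polynomial k ⧸ I i)).compr₂ (l i)).compl₁₂ (c i) (c i)
  have hB (v w : V) : B v w = ∑ i, l i (c i v * c i w) := by
    simp [B, LinearMap.sum_apply]
  have hinj : Function.Injective B := by
    rw [← LinearMap.ker_eq_bot, LinearMap.ker_eq_bot']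
    intro v hv
    refine hc v fun i => hl i _ fun b => ?_
    obtain ⟨w, hw, hw'⟩ := hcs i b
    have h : B v w = 0 := by rw [hv, LinearMap.zero_apply]
    rwa [hB, Finset.sum_eq_single i (fun j _ hj => by rw [hw' j hj, mul_zero, map_zero])
      (by simp), hw] at h
  refine ⟨LinearEquiv.ofInjectiveOfFinrankEq B hinj Subspace.dual_finrank_eq.symm, fun v => ?_⟩
  ext w
  change B (x v) w = B v (x w)
  rw [hB, hB]
  refine Finset.sum_congr rfl fun i _ => ?_
  rw [hcx, hcx, mul_assoc, mul_left_comm]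

section

variable {k M N R : Type} [Field k] [AddCommGroup M] [Module k M] [AddCommGroup N] [Module k N]
  [AddCommGroup R] [Module k R]

/-- `L` is the middle of a short exact sequence `0 → N → R → M → 0` of pairs. -/
def IsHallSubspace (xM : M →ₗ[k] M) (xN : N →ₗ[k] N) (xR : R →ₗ[k] R) (L : Submodule k R) :
    Prop :=
  ∃ (i : N →ₗ[k] R) (q : R →ₗ[k] M), Function.Injective i ∧ Function.Surjective q ∧
    LinearMap.range i = L ∧ LinearMap.ker q = L ∧
    (∀ v, i (xN v) = xR (i v)) ∧ ∀ v, q (xR v) = xM (q v)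

theorem isHallSubspace_iff (xM : M →ₗ[k] M) (xN : N →ₗ[k] N) (xR : R →ₗ[k] R)
    (L : Submodule k R) :
    IsHallSubspace xM xN xR L ↔ ∃ hL : ∀ v ∈ L, xR v ∈ L,
      (∃ e : ↥L ≃ₗ[k] N, ∀ (v : R) (hv : v ∈ L), e ⟨xR v, hL v hv⟩ = xN (e ⟨v, hv⟩)) ∧
      (∃ f : (R ⧸ L) ≃ₗ[k] M, ∀ v : R,
        f (Submodule.Quotient.mk (xR v)) = xM (f (Submodule.Quotient.mk v))) := by
  constructor
  · rintro ⟨i, q, hi, hq, hiL, rfl, hix, hqx⟩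
    refine ⟨fun v hv => ?_, ?_, q.quotKerEquivOfSurjective hq, hqx⟩
    · rw [LinearMap.mem_ker] at hv ⊢
      rw [hqx, hv, map_zero]
    · let e := (LinearEquiv.ofInjective i hi).trans (LinearEquiv.ofEq _ _ hiL)
      refine ⟨e.symm, fun v hv => ?_⟩
      rw [LinearEquiv.symm_apply_eq]
      obtain ⟨n, hn⟩ := e.surjective ⟨v, hv⟩
      rw [← hn, LinearEquiv.symm_apply_apply]
      have hv' : i n = v := congrArg Subtype.val hn
      ext
      change xR v = i (xN n)
      rw [hix, hv']
  · rintro ⟨hL, ⟨e, he⟩, f, hf⟩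
    refine ⟨L.subtype.comp e.symm.toLinearMap, f.toLinearMap.comp L.mkQ,
      L.injective_subtype.comp e.symm.injective, f.surjective.comp L.mkQ_surjective, ?_, ?_,
      fun v => ?_, hf⟩
    · simp [LinearMap.range_comp]
    · simp [LinearMap.ker_comp]
    · obtain ⟨⟨w, hw⟩, rfl⟩ := e.surjective v
      rw [← he]
      simp

theorem hallPairCount_eq_card_isHallSubspace (xM : M →ₗ[k] M) (xN : N →ₗ[k] N)
    (xR : R →ₗ[k] R) :
    hallPairCount k xM xN xR = Nat.card {L : Submodule k R // IsHallSubspace xM xN xR L} :=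
  Nat.card_congr (Equiv.subtypeEquivRight fun L => (isHallSubspace_iff xM xN xR L).symm)

/-- Self-duality of pairs turns a Hall subspace into one with the roles of sub and quotient
exchanged. -/
theorem IsHallSubspace.comap_dualAnnihilator
    {xM : M →ₗ[k] M} {xN : N →ₗ[k] N} {xR : R →ₗ[k] R} {L : Submodule k R}
    (φM : M ≃ₗ[k] Module.Dual k M) (hφM : ∀ v, φM (xM v) = xM.dualMap (φM v))
    (φN : N ≃ₗ[k] Module.Dual k N) (hφN : ∀ v, φN (xN v) = xN.dualMap (φN v))
    (φR : R ≃ₗ[k] Module.Dual k R) (hφR : ∀ v, φR (xR v) = xR.dualMap (φR v))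
    (h : IsHallSubspace xM xN xR L) :
    IsHallSubspace xN xM xR (L.dualAnnihilator.comap φR.toLinearMap) := by
  obtain ⟨i, q, hi, hq, hiL, hqL, hix, hqx⟩ := h
  refine ⟨φR.symm.toLinearMap ∘ₗ q.dualMap ∘ₗ φM.toLinearMap,
    φN.symm.toLinearMap ∘ₗ i.dualMap ∘ₗ φR.toLinearMap, ?_, ?_, ?_, ?_, fun v => ?_, fun v => ?_⟩
  · exact φR.symm.injective.comp
      ((LinearMap.dualMap_injective_of_surjective hq).comp φM.injective)
  · exact φN.symm.surjective.comp
      ((LinearMap.dualMap_surjective_of_injective hi).comp φR.surjective)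
  · rw [LinearMap.range_comp, LinearMap.range_comp_of_range_eq_top _ φM.range,
      LinearMap.range_dualMap_eq_dualAnnihilator_ker, hqL]
    exact Submodule.map_equiv_eq_comap_symm φR.symm _
  · rw [LinearEquiv.ker_comp, LinearMap.ker_comp,
      LinearMap.ker_dualMap_eq_dualAnnihilator_range, hiL]
  · apply φR.injective
    ext w
    simp [hφR, hφM, hqx]
  · apply φN.injective
    ext w
    simp [hφR, hφN, hix]

theorem hallPairCount_le_swap [Finite k] [FiniteDimensional k M] [FiniteDimensional k N]
    [FiniteDimensional k R] (xM : M →ₗ[k] M) (xN : N →ₗ[k] N) (xR : R →ₗ[k] R) :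
    hallPairCount k xM xN xR ≤ hallPairCount k xN xM xR := by
  obtain ⟨φM, hφM⟩ := xM.exists_equiv_dual_intertwining
  obtain ⟨φN, hφN⟩ := xN.exists_equiv_dual_intertwining
  obtain ⟨φR, hφR⟩ := xR.exists_equiv_dual_intertwining
  have : Finite R := Module.finite_of_finite k
  rw [hallPairCount_eq_card_isHallSubspace, hallPairCount_eq_card_isHallSubspace]
  refine Nat.card_le_card_of_injective
    (fun L => ⟨_, L.2.comap_dualAnnihilator φM hφM φN hφN φR hφR⟩) fun L L' h => ?_
  have h' := Submodule.comap_injective_of_surjective φR.surjective (congrArg Subtype.val h)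
  exact Subtype.ext (Subspace.dualAnnihilator_inj.mp h')

end

/-- Commutativity of Steinitz's classical Hall algebra: for finite-dimensional vector
spaces `M, N, R` over a finite field `k`, each with a nilpotent endomorphism, the number of
invariant subspaces `L ⊆ R` with `(L, xR|_L) ≅ (N, xN)` and `(R/L, ·) ≅ (M, xM)` equals the
number of invariant subspaces `L ⊆ R` with `(L, xR|_L) ≅ (M, xM)` and `(R/L, ·) ≅ (N, xN)`. -/
theorem classical_hall_commutative
    (k : Type) [Field k] [Fintype k]
    (M N R : Type)
    [AddCommGroup M] [Module k M] [FiniteDimensional k M]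
    [AddCommGroup N] [Module k N] [FiniteDimensional k N]
    [AddCommGroup R] [Module k R] [FiniteDimensional k R]
    (xM : M →ₗ[k] M) (xN : N →ₗ[k] N) (xR : R →ₗ[k] R)
    (hM : IsNilpotent xM) (hN : IsNilpotent xN) (hR : IsNilpotent xR) :
    hallPairCount k xM xN xR = hallPairCount k xN xM xR := by
  exact le_antisymm (hallPairCount_le_swap xM xN xR) (hallPairCount_le_swap xN xM xR)
end
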